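/- Let g₁,…,g_m ∈ ℝ[x₁,…,xₙ] and suppose K = {x ∈ ℝⁿ : g_j(x) ≥ 0 for j = 1,…,m} is compact. Let z = (z_{αk}), (α,k) ∈ ℕⁿ × ℕ, be a real sequence such that L_z(h² · g^β) ≥ 0 for every β ∈ {0,1}^m and every polynomial h ∈ ℝ[x₁,…,xₙ,t]. Then z has a representing measure on K × ℝ: there exists a finite Borel measure ν on ℝⁿ × ℝ supported on K × ℝ with z_{αk} = ∫ x^α t^k dν(x,t) for all (α,k) ∈ ℕⁿ × ℕ. -/

import Mathlib

open MeasureTheory Polynomial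

/-- The Riesz functional of a sequence `z = (z_{αk})`, acting on `ℝ[x₁,…,xₙ][t]`:
`L_z(x^α t^k) = z_{αk}`, extended linearly. -/
noncomputable def riesz {n : ℕ} (z : (Fin n →₀ ℕ) × ℕ → ℝ)
    (f : Polynomial (MvPolynomial (Fin n) ℝ)) : ℝ :=
  f.sum fun k c => ∑ α ∈ c.support, MvPolynomial.coeff α c * z (α, k)

set_option linter.unusedSectionVars false

/-- The intermediate value property for polynomials over an ordered field. -/
def PolyIVT (R : Type*) [Field R] [LinearOrder R] : Prop :=
  ∀ (f : R[X]) (a b : R), a < b → f.eval a < 0 → 0 < f.eval b → ∃ c ∈ Set.Ioo a b, f.eval c = 0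

section OrderedField

variable {R : Type*} [Field R] [LinearOrder R] [IsStrictOrderedRing R]

theorem Polynomial.exists_forall_abs_sub_lt_eval_pos {f : R[X]} {a : R} (h : 0 < f.eval a) :
    ∃ ε > 0, ∀ x, |x - a| < ε → 0 < f.eval x := by
  let _ : TopologicalSpace R := Preorder.topology R
  have : OrderTopology R := ⟨rfl⟩
  have hc : Continuous fun x => f.eval x := f.continuous
  have := hc.continuousAt.eventually (lt_mem_nhds h)
  obtain ⟨ε, hε, hs⟩ := (nhds_basis_abs_sub_lt a).eventually_iff.1 this
  exact ⟨ε, hε, fun x hx => hs hx⟩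

theorem Polynomial.exists_sub_mul_eval_mul_eval_derivative_pos {p : R[X]} (hp : p ≠ 0) {a : R}
    (ha : p.eval a = 0) :
    ∃ ε > 0, ∀ x, |x - a| < ε → x ≠ a → 0 < (x - a) * (p.eval x * p.derivative.eval x) := by
  obtain ⟨q, hq, hqa⟩ := exists_eq_pow_rootMultiplicity_mul_and_not_dvd p hp a
  have hm : 0 < p.rootMultiplicity a := (rootMultiplicity_pos hp).2 ha
  obtain ⟨m, hm'⟩ : ∃ m, p.rootMultiplicity a = m + 1 := ⟨_, (Nat.succ_pred_eq_of_pos hm).symm⟩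
  rw [hm'] at hq
  rw [dvd_iff_isRoot, IsRoot] at hqa
  set w : R[X] := q * (C ((m : R) + 1) * q + (X - C a) * derivative q) with hw
  have hwa : 0 < w.eval a := by
    simp only [hw, eval_mul, eval_add, eval_C, eval_sub, eval_X, sub_self, zero_mul, add_zero]
    have : 0 < eval a q * eval a q := mul_self_pos.2 hqa
    have h2 : (0 : R) < m + 1 := by positivity
    nlinarith [mul_pos this h2]
  obtain ⟨ε, hε, h⟩ := exists_forall_abs_sub_lt_eval_pos hwa
  refine ⟨ε, hε, fun x hx hxa => ?_⟩
  have key : (x - a) * (p.eval x * p.derivative.eval x) = ((x - a) ^ (m + 1)) ^ 2 * w.eval x := by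
    rw [hq, hw]
    simp only [derivative_mul, derivative_X_sub_C_pow, eval_mul, eval_add, eval_C, eval_sub, eval_X,
      eval_pow, Nat.cast_add, Nat.cast_one, Nat.add_sub_cancel]
    ring
  rw [key]
  have := h x hx
  have h3 : x - a ≠ 0 := sub_ne_zero.2 hxa
  positivity

theorem Polynomial.exists_forall_le_abs_eval {p : R[X]} (hp : 0 < p.natDegree) (M : R) :
    ∃ B, ∀ x, B ≤ |x| → M ≤ |p.eval x| := by
  suffices H : ∀ n, ∀ p : R[X], p.natDegree = n + 1 → ∀ M, ∃ B, ∀ x, B ≤ |x| → M ≤ |p.eval x| from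
    H (p.natDegree - 1) p (by omega) M
  intro n
  induction n with
  | zero =>
    intro p hp M
    obtain ⟨a, ha, b, rfl⟩ := natDegree_eq_one.1 hp
    refine ⟨(M + |b|) / |a|, fun x hx => ?_⟩
    have ha' : 0 < |a| := abs_pos.2 ha
    rw [div_le_iff₀ ha'] at hx
    simp only [eval_add, eval_mul, eval_C, eval_X]
    have := abs_sub_abs_le_abs_sub (a * x) (-b)
    rw [abs_neg, sub_neg_eq_add, abs_mul] at this
    linarith [mul_comm |x| |a|]
  | succ n ih =>
    intro p hp M
    obtain ⟨B, hB⟩ := ih p.divX (by rw [natDegree_divX_eq_natDegree_tsub_one, hp]; rfl)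
      (|M| + |p.coeff 0|)
    refine ⟨max B 1, fun x hx => ?_⟩
    have h1 := hB x ((le_max_left _ _).trans hx)
    have h2 : 1 ≤ |x| := (le_max_right _ _).trans hx
    rw [← divX_mul_X_add p]
    simp only [eval_add, eval_mul, eval_C, eval_X]
    have := abs_sub_abs_le_abs_sub (eval x p.divX * x) (-p.coeff 0)
    rw [abs_neg, sub_neg_eq_add, abs_mul] at this
    have : |eval x p.divX| ≤ |eval x p.divX| * |x| := le_mul_of_one_le_right (abs_nonneg _) h2
    linarith [le_abs_self M]

end OrderedField

namespace PolyIVT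

variable {R : Type*} [Field R] [LinearOrder R] [IsStrictOrderedRing R]

theorem exists_root_of_mul_neg (h : PolyIVT R) {f : R[X]} {a b : R} (hab : a < b)
    (hf : f.eval a * f.eval b < 0) : ∃ c ∈ Set.Ioo a b, f.eval c = 0 := by
  rcases mul_neg_iff.1 hf with ⟨h1, h2⟩ | ⟨h1, h2⟩
  · obtain ⟨c, hc, h⟩ := h (-f) a b hab (by simpa using h1) (by simpa using h2)
    exact ⟨c, hc, by simpa using h⟩
  · exact h f a b hab h1 h2

theorem sign_eval_eq (h : PolyIVT R) {f : R[X]} {s : Set R} (hs : s.OrdConnected)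
    (hf : ∀ x ∈ s, f.eval x ≠ 0) {x y : R} (hx : x ∈ s) (hy : y ∈ s) :
    SignType.sign (f.eval x) = SignType.sign (f.eval y) := by
  wlog hxy : x < y generalizing x y
  · rcases (not_lt.1 hxy).eq_or_lt with rfl | hlt
    · rfl
    · exact (this hy hx hlt).symm
  have h1 : 0 ≤ f.eval x * f.eval y := by
    by_contra! hlt
    obtain ⟨c, hc, hc0⟩ := h.exists_root_of_mul_neg hxy hlt
    exact hf c (hs.out hx hy ⟨hc.1.le, hc.2.le⟩) hc0
  have h2 : 0 < f.eval x * f.eval y := h1.lt_of_ne' (mul_ne_zero (hf x hx) (hf y hy))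
  rcases mul_pos_iff.1 h2 with ⟨h1, h2⟩ | ⟨h1, h2⟩ <;> simp [h1, h2]

theorem eval_lt_eval (h : PolyIVT R) {p : R[X]} {a b : R} (hab : a < b)
    (hp : ∀ x ∈ Set.Ioo a b, 0 < p.derivative.eval x) : p.eval a < p.eval b := by
  wlog ha : p.eval a = 0 generalizing p
  · have := this (p := p - C (p.eval a)) (by simpa using hp) (by simp)
    simpa using this
  rw [ha]
  by_contra! hb
  have hp0 : p ≠ 0 := by
    rintro rfl
    obtain ⟨c, hc⟩ := exists_between hab
    simpa using hp c hc
  obtain ⟨ε, hε, hpos⟩ := exists_sub_mul_eval_mul_eval_derivative_pos hp0 ha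
  obtain ⟨x₀, hx₀, hx₀'⟩ := exists_between (lt_min hab (lt_add_of_pos_right a hε))
  rw [lt_min_iff] at hx₀'
  have hx₀pos : 0 < p.eval x₀ := by
    have h1 := hpos x₀ (by rw [abs_of_pos] <;> linarith) hx₀.ne'
    have h2 := hp x₀ ⟨hx₀, hx₀'.1⟩
    have h3 : 0 < x₀ - a := sub_pos.2 hx₀
    exact pos_of_mul_pos_left (pos_of_mul_pos_right h1 h3.le) h2.le
  have hex : ∃ c ∈ Set.Ioc x₀ b, p.eval c = 0 := by
    rcases hb.eq_or_lt with hb | hb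
    · exact ⟨b, ⟨hx₀'.1, le_rfl⟩, hb⟩
    · obtain ⟨c, hc, h0⟩ := h.exists_root_of_mul_neg hx₀'.1 (mul_neg_of_pos_of_neg hx₀pos hb)
      exact ⟨c, ⟨hc.1, hc.2.le⟩, h0⟩
  obtain ⟨c, hc, hc0, hmin⟩ : ∃ c ∈ Set.Ioc x₀ b, p.eval c = 0 ∧
      ∀ y ∈ Set.Ico x₀ c, p.eval y ≠ 0 := by
    have hne : (p.roots.toFinset.filter (· ∈ Set.Ioc x₀ b)).Nonempty := by
      obtain ⟨c, hc, h0⟩ := hex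
      exact ⟨c, by simp only [Finset.mem_filter, Multiset.mem_toFinset]; exact ⟨by simp [hp0, h0], hc⟩⟩
    obtain ⟨c, hc, hmin⟩ := Finset.exists_min_image _ id hne
    simp only [Finset.mem_filter, Multiset.mem_toFinset, mem_roots hp0, IsRoot.def] at hc hmin
    refine ⟨c, hc.2, hc.1, fun y hy h0 => ?_⟩
    rcases hy.1.eq_or_lt with rfl | hlt
    · exact hx₀pos.ne' h0
    · exact absurd (hmin y ⟨h0, hlt, hy.2.le.trans hc.2.2⟩) (not_le.2 hy.2)
  obtain ⟨δ, hδ, hneg⟩ := exists_sub_mul_eval_mul_eval_derivative_pos hp0 hc0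
  obtain ⟨y, hy, hy'⟩ := exists_between (max_lt hc.1 (sub_lt_self c hδ))
  rw [max_lt_iff] at hy
  have h1 := hneg y (by rw [abs_of_neg] <;> linarith) hy'.ne
  have h2 : 0 < p.eval y := by
    have := h.sign_eval_eq Set.ordConnected_Ico hmin ⟨le_rfl, hc.1⟩ ⟨hy.1.le, hy'⟩
    rw [sign_pos hx₀pos] at this
    exact sign_eq_one_iff.1 this.symm
  have h3 := hp y ⟨hx₀.trans hy.1, hy'.trans_le hc.2⟩
  have h4 : y - c < 0 := sub_neg.2 hy'
  nlinarith [mul_pos h2 h3]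

end PolyIVT

/-- The open interval of points lying above a finite set `A` and below a finite set `B`. -/
def finsetGap {R : Type*} [LT R] (A B : Finset R) : Set R :=
  {x | (∀ a ∈ A, a < x) ∧ ∀ b ∈ B, x < b}

section finsetGap

theorem ordConnected_finsetGap {R : Type*} [Preorder R] {A B : Finset R} : (finsetGap A B).OrdConnected :=
  ⟨fun _ hx _ hy _ hz => ⟨fun a ha => (hx.1 a ha).trans_le hz.1, fun b hb => hz.2.trans_lt (hy.2 b hb)⟩⟩

variable {R : Type*} [Field R] [LinearOrder R] [IsStrictOrderedRing R] {A B : Finset R}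

theorem exists_lt_mem_finsetGap {x : R} (hx : x ∈ finsetGap A B) : ∃ y ∈ finsetGap A B, y < x := by
  obtain ⟨y, hy, hy'⟩ := Order.exists_between_finsets A {x} (by simpa using hx.1)
  have hyx : y < x := by simpa using hy'
  exact ⟨y, ⟨hy, fun b hb => hyx.trans (hx.2 b hb)⟩, hyx⟩

theorem exists_gt_mem_finsetGap {x : R} (hx : x ∈ finsetGap A B) : ∃ y ∈ finsetGap A B, x < y := by
  obtain ⟨y, hy, hy'⟩ := Order.exists_between_finsets {x} B (by simpa using hx.2)
  have hyx : x < y := by simpa using hy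
  exact ⟨y, ⟨fun a ha => (hx.1 a ha).trans hyx, hy'⟩, hyx⟩

theorem infinite_finsetGap (h : (finsetGap A B).Nonempty) : (finsetGap A B).Infinite := by
  intro hfin
  obtain ⟨x, hx, hmax⟩ := Set.exists_max_image _ id hfin h
  obtain ⟨y, hy, hxy⟩ := exists_gt_mem_finsetGap hx
  exact (hmax y hy).not_gt hxy

namespace PolyIVT

theorem eval_lt_eval_of_mem_finsetGap (h : PolyIVT R) {p : R[X]}
    (hp : ∀ x ∈ finsetGap A B, 0 < p.derivative.eval x) {x y : R} (hx : x ∈ finsetGap A B)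
    (hy : y ∈ finsetGap A B) (hxy : x < y) : p.eval x < p.eval y :=
  h.eval_lt_eval hxy fun _ hz => hp _ (ordConnected_finsetGap.out hx hy ⟨hz.1.le, hz.2.le⟩)

theorem exists_mem_finsetGap_eval_pos_iff (h : PolyIVT R) {p : R[X]} (hdeg : 0 < p.natDegree)
    (hne : (finsetGap A B).Nonempty) (hp : ∀ x ∈ finsetGap A B, 0 < p.derivative.eval x) :
    (∃ x ∈ finsetGap A B, 0 < p.eval x) ↔ ∀ b ∈ B, (∀ b' ∈ B, b ≤ b') → 0 < p.eval b := by
  constructor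
  · rintro ⟨x, hx, hpx⟩ b hb hmin
    refine hpx.trans (h.eval_lt_eval (hx.2 b hb) fun y hy => hp y ⟨fun a ha => ?_, fun b' hb' => ?_⟩)
    · exact (hx.1 a ha).trans hy.1
    · exact hy.2.trans_le (hmin b' hb')
  · intro H
    obtain ⟨x₀, hx₀⟩ := hne
    rcases B.eq_empty_or_nonempty with rfl | hB
    · obtain ⟨M, hM⟩ := exists_forall_le_abs_eval hdeg (|p.eval x₀| + 1)
      have hlt : x₀ < max (x₀ + 1) M := (lt_add_one x₀).trans_le (le_max_left _ _)
      have hmem : max (x₀ + 1) M ∈ finsetGap A ∅ := ⟨fun a ha => (hx₀.1 a ha).trans hlt, by simp⟩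
      refine ⟨_, hmem, ?_⟩
      have h1 := h.eval_lt_eval_of_mem_finsetGap hp hx₀ hmem hlt
      have h2 := hM (max (x₀ + 1) M) ((le_max_right _ _).trans (le_abs_self _))
      by_contra! h3
      rw [abs_of_nonpos h3] at h2
      linarith [neg_abs_le (p.eval x₀)]
    · have hb := B.min'_mem hB
      obtain ⟨ε, hε, hpos⟩ := exists_forall_abs_sub_lt_eval_pos
        (H (B.min' hB) hb fun b' hb' => B.min'_le b' hb')
      obtain ⟨x, hx, hx'⟩ := exists_between (max_lt (hx₀.2 _ hb) (sub_lt_self (B.min' hB) hε))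
      rw [max_lt_iff] at hx
      refine ⟨x, ⟨fun a ha => (hx₀.1 a ha).trans hx.1, fun b' hb' => hx'.trans_le (B.min'_le b' hb')⟩,
        hpos x ?_⟩
      rw [abs_of_neg] <;> linarith

theorem exists_mem_finsetGap_eval_neg_iff (h : PolyIVT R) {p : R[X]} (hdeg : 0 < p.natDegree)
    (hne : (finsetGap A B).Nonempty) (hp : ∀ x ∈ finsetGap A B, 0 < p.derivative.eval x) :
    (∃ x ∈ finsetGap A B, p.eval x < 0) ↔ ∀ a ∈ A, (∀ a' ∈ A, a' ≤ a) → p.eval a < 0 := by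
  have hmem : ∀ x, x ∈ finsetGap (B.image Neg.neg) (A.image Neg.neg) ↔ -x ∈ finsetGap A B := by
    intro x
    simp only [finsetGap, Set.mem_ofPred_eq, Finset.forall_mem_image]
    constructor
    · exact fun hx => ⟨fun a ha => by linarith [hx.2 ha], fun b hb => by linarith [hx.1 hb]⟩
    · exact fun hx => ⟨fun b hb => by linarith [hx.2 b hb], fun a ha => by linarith [hx.1 a ha]⟩
  have key := h.exists_mem_finsetGap_eval_pos_iff (p := -p.comp (-X)) (A := B.image Neg.neg)
    (B := A.image Neg.neg) (by rw [natDegree_neg, natDegree_comp]; simpa using hdeg)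
    (by obtain ⟨x, hx⟩ := hne; exact ⟨-x, (hmem _).2 (by simpa using hx)⟩)
    (fun x hx => by simpa [derivative_comp] using hp _ ((hmem x).1 hx))
  simp only [Finset.forall_mem_image, eval_neg, eval_comp, eval_X, neg_neg, neg_le_neg_iff,
    Left.neg_pos_iff] at key
  rw [← key]
  constructor
  · rintro ⟨x, hx, hx'⟩
    exact ⟨-x, (hmem _).2 (by simpa using hx), by simpa using hx'⟩
  · rintro ⟨x, hx, hx'⟩
    exact ⟨-x, (hmem _).1 hx, hx'⟩

end PolyIVT

end finsetGap

section Comparison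

variable {R S : Type*} [Field R] [LinearOrder R] [IsStrictOrderedRing R]
  [Field S] [LinearOrder S] [IsStrictOrderedRing S]

theorem PolyIVT.exists_root_of_exists_pos_of_exists_neg (hR : PolyIVT R) {C : Set R}
    (hC : C.OrdConnected) {p : R[X]} (h₁ : ∃ x ∈ C, 0 < p.eval x) (h₂ : ∃ x ∈ C, p.eval x < 0) :
    ∃ x ∈ C, p.eval x = 0 := by
  by_contra! H
  obtain ⟨x, hx, hx'⟩ := h₁
  obtain ⟨y, hy, hy'⟩ := h₂
  have := hR.sign_eval_eq hC H hx hy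
  rw [sign_pos hx', sign_neg hy'] at this
  exact absurd this (by decide)

/-- Over two fields with the intermediate value property, a pair of increasing polynomials with
matching signs at the ends of corresponding gaps behave in the same way on these gaps. -/
theorem finsetGap_comparison_of_pos (hR : PolyIVT R) (hS : PolyIVT S) {A B : Finset R} {f : R → S}
    (hA : ∀ a ∈ A, ∀ a' ∈ A, f a ≤ f a' ↔ a ≤ a') (hB : ∀ a ∈ B, ∀ a' ∈ B, f a ≤ f a' ↔ a ≤ a')
    {p : R[X]} {q : S[X]} (hp : 0 < p.natDegree) (hq : 0 < q.natDegree)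
    (hne : (finsetGap A B).Nonempty) (hne' : (finsetGap (A.image f) (B.image f)).Nonempty)
    (hsA : ∀ a ∈ A, SignType.sign (p.eval a) = SignType.sign (q.eval (f a)))
    (hsB : ∀ a ∈ B, SignType.sign (p.eval a) = SignType.sign (q.eval (f a)))
    (hp' : ∀ x ∈ finsetGap A B, 0 < p.derivative.eval x)
    (hq' : ∀ x ∈ finsetGap (A.image f) (B.image f), 0 < q.derivative.eval x) :
    ((∃ x ∈ finsetGap A B, p.eval x = 0) → ∃ y ∈ finsetGap (A.image f) (B.image f), q.eval y = 0) ∧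
    (∀ x ∈ finsetGap A B, ∀ y ∈ finsetGap (A.image f) (B.image f),
      (∀ ρ ∈ finsetGap A B, ∀ η ∈ finsetGap (A.image f) (B.image f), p.eval ρ = 0 → q.eval η = 0 →
        ((x < ρ ↔ y < η) ∧ (ρ < x ↔ η < y))) →
      SignType.sign (p.eval x) = SignType.sign (q.eval y)) := by
  have hpos : (∃ x ∈ finsetGap A B, 0 < p.eval x) ↔
      ∃ y ∈ finsetGap (A.image f) (B.image f), 0 < q.eval y := by
    rw [hR.exists_mem_finsetGap_eval_pos_iff hp hne hp',
      hS.exists_mem_finsetGap_eval_pos_iff hq hne' hq']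
    simp only [Finset.forall_mem_image]
    refine forall₂_congr fun b hb => ?_
    have h1 : (∀ b' ∈ B, b ≤ b') ↔ ∀ ⦃b'⦄, b' ∈ B → f b ≤ f b' :=
      forall₂_congr fun b' hb' => (hB b hb b' hb').symm
    rw [h1, ← sign_eq_one_iff, hsB b hb, sign_eq_one_iff]
  have hneg : (∃ x ∈ finsetGap A B, p.eval x < 0) ↔
      ∃ y ∈ finsetGap (A.image f) (B.image f), q.eval y < 0 := by
    rw [hR.exists_mem_finsetGap_eval_neg_iff hp hne hp',
      hS.exists_mem_finsetGap_eval_neg_iff hq hne' hq']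
    simp only [Finset.forall_mem_image]
    refine forall₂_congr fun b hb => ?_
    have h1 : (∀ b' ∈ A, b' ≤ b) ↔ ∀ ⦃b'⦄, b' ∈ A → f b' ≤ f b :=
      forall₂_congr fun b' hb' => (hA b' hb' b hb).symm
    rw [h1, ← sign_eq_neg_one_iff, hsA b hb, sign_eq_neg_one_iff]
  have monoR : ∀ {x y : R}, x ∈ finsetGap A B → y ∈ finsetGap A B → x < y → p.eval x < p.eval y :=
    fun hx hy hxy => hR.eval_lt_eval_of_mem_finsetGap hp' hx hy hxy
  have monoS : ∀ {x y : S}, x ∈ finsetGap (A.image f) (B.image f) →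
      y ∈ finsetGap (A.image f) (B.image f) → x < y → q.eval x < q.eval y :=
    fun hx hy hxy => hS.eval_lt_eval_of_mem_finsetGap hq' hx hy hxy
  have hroot : (∃ x ∈ finsetGap A B, p.eval x = 0) →
      ∃ y ∈ finsetGap (A.image f) (B.image f), q.eval y = 0 := by
    rintro ⟨x, hx, hx0⟩
    refine hS.exists_root_of_exists_pos_of_exists_neg ordConnected_finsetGap (hpos.1 ?_) (hneg.1 ?_)
    · obtain ⟨z, hz, hxz⟩ := exists_gt_mem_finsetGap hx
      exact ⟨z, hz, hx0 ▸ monoR hx hz hxz⟩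
    · obtain ⟨z, hz, hxz⟩ := exists_lt_mem_finsetGap hx
      exact ⟨z, hz, hx0 ▸ monoR hz hx hxz⟩
  refine ⟨hroot, fun x hx y hy H => ?_⟩
  rcases lt_trichotomy (p.eval x) 0 with hlt | h0 | hgt
  · rw [sign_neg hlt, eq_comm, sign_eq_neg_one_iff]
    by_contra! hqy
    have hqneg := hneg.1 ⟨x, hx, hlt⟩
    obtain ⟨η, hη, hη0, hle⟩ : ∃ η ∈ finsetGap (A.image f) (B.image f), q.eval η = 0 ∧ η ≤ y := by
      rcases hqy.eq_or_lt with h0 | hpos'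
      · exact ⟨y, hy, h0.symm, le_rfl⟩
      · obtain ⟨η, hη, hη0⟩ := hS.exists_root_of_exists_pos_of_exists_neg ordConnected_finsetGap
          ⟨y, hy, hpos'⟩ hqneg
        refine ⟨η, hη, hη0, not_lt.1 fun hlt' => ?_⟩
        exact absurd (monoS hy hη hlt') (by rw [hη0]; exact hpos'.not_gt)
    obtain ⟨z, hz, hηz⟩ := exists_gt_mem_finsetGap hη
    obtain ⟨ρ, hρ, hρ0⟩ := hR.exists_root_of_exists_pos_of_exists_neg ordConnected_finsetGap
      (hpos.2 ⟨z, hz, hη0 ▸ monoS hη hz hηz⟩) ⟨x, hx, hlt⟩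
    have hxρ : x < ρ := by
      by_contra! hle'
      rcases hle'.eq_or_lt with rfl | hlt'
      · exact hlt.ne hρ0
      · exact absurd (monoR hρ hx hlt') (by rw [hρ0]; exact hlt.not_gt)
    exact (((H ρ hρ η hη hρ0 hη0).1.1 hxρ).not_ge) hle
  · obtain ⟨η, hη, hη0⟩ := hroot ⟨x, hx, h0⟩
    have := H x hx η hη h0 hη0
    simp only [lt_self_iff_false, false_iff, not_lt] at this
    rw [le_antisymm this.2 this.1, h0, hη0]
    simp
  · rw [sign_pos hgt, eq_comm, sign_eq_one_iff]
    by_contra! hqy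
    have hqpos := hpos.1 ⟨x, hx, hgt⟩
    obtain ⟨η, hη, hη0, hle⟩ : ∃ η ∈ finsetGap (A.image f) (B.image f), q.eval η = 0 ∧ y ≤ η := by
      rcases hqy.eq_or_lt with h0 | hneg'
      · exact ⟨y, hy, h0, le_rfl⟩
      · obtain ⟨η, hη, hη0⟩ := hS.exists_root_of_exists_pos_of_exists_neg ordConnected_finsetGap
          hqpos ⟨y, hy, hneg'⟩
        refine ⟨η, hη, hη0, not_lt.1 fun hlt' => ?_⟩
        exact absurd (monoS hη hy hlt') (by rw [hη0]; exact hneg'.not_gt)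
    obtain ⟨z, hz, hηz⟩ := exists_lt_mem_finsetGap hη
    obtain ⟨ρ, hρ, hρ0⟩ := hR.exists_root_of_exists_pos_of_exists_neg ordConnected_finsetGap
      ⟨x, hx, hgt⟩ (hneg.2 ⟨z, hz, hη0 ▸ monoS hz hη hηz⟩)
    have hxρ : ρ < x := by
      by_contra! hle'
      rcases hle'.eq_or_lt with rfl | hlt'
      · exact hgt.ne' hρ0
      · exact absurd (monoR hx hρ hlt') (by rw [hρ0]; exact hgt.not_gt)
    exact (((H ρ hρ η hη hρ0 hη0).2.1 hxρ).not_ge) hle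

theorem finsetGap_comparison (hR : PolyIVT R) (hS : PolyIVT S) {A B : Finset R} {f : R → S}
    (hA : ∀ a ∈ A, ∀ a' ∈ A, f a ≤ f a' ↔ a ≤ a') (hB : ∀ a ∈ B, ∀ a' ∈ B, f a ≤ f a' ↔ a ≤ a')
    {p : R[X]} {q : S[X]} (hp : 0 < p.natDegree) (hq : 0 < q.natDegree)
    (hne : (finsetGap A B).Nonempty) (hne' : (finsetGap (A.image f) (B.image f)).Nonempty)
    (hsA : ∀ a ∈ A, SignType.sign (p.eval a) = SignType.sign (q.eval (f a)))
    (hsB : ∀ a ∈ B, SignType.sign (p.eval a) = SignType.sign (q.eval (f a)))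
    {s : SignType} (hs : s ≠ 0)
    (hp' : ∀ x ∈ finsetGap A B, SignType.sign (p.derivative.eval x) = s)
    (hq' : ∀ x ∈ finsetGap (A.image f) (B.image f), SignType.sign (q.derivative.eval x) = s) :
    ((∃ x ∈ finsetGap A B, p.eval x = 0) → ∃ y ∈ finsetGap (A.image f) (B.image f), q.eval y = 0) ∧
    (∀ x ∈ finsetGap A B, ∀ y ∈ finsetGap (A.image f) (B.image f),
      (∀ ρ ∈ finsetGap A B, ∀ η ∈ finsetGap (A.image f) (B.image f), p.eval ρ = 0 → q.eval η = 0 →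
        ((x < ρ ↔ y < η) ∧ (ρ < x ↔ η < y))) →
      SignType.sign (p.eval x) = SignType.sign (q.eval y)) := by
  cases s with
  | zero => exact absurd rfl hs
  | pos =>
    exact finsetGap_comparison_of_pos hR hS hA hB hp hq hne hne' hsA hsB
      (fun x hx => sign_eq_one_iff.1 (hp' x hx)) (fun x hx => sign_eq_one_iff.1 (hq' x hx))
  | neg =>
    have := finsetGap_comparison_of_pos hR hS hA hB (p := -p) (q := -q) (by simpa) (by simpa)
      hne hne' (by simpa [Left.sign_neg] using hsA) (by simpa [Left.sign_neg] using hsB)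
      (fun x hx => by simpa using sign_eq_neg_one_iff.1 (hp' x hx))
      (fun x hx => by simpa using sign_eq_neg_one_iff.1 (hq' x hx))
    simpa [Left.sign_neg] using this

theorem PolyIVT.eq_of_eval_eq_zero (hR : PolyIVT R) {A B : Finset R} {p : R[X]} {s : SignType}
    (hs : s ≠ 0) (hp' : ∀ x ∈ finsetGap A B, SignType.sign (p.derivative.eval x) = s) {x y : R}
    (hx : x ∈ finsetGap A B) (hy : y ∈ finsetGap A B) (hpx : p.eval x = 0) (hpy : p.eval y = 0) :
    x = y := by
  wlog hxy : x < y generalizing x y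
  · exact (not_lt.1 hxy).eq_or_lt.elim Eq.symm fun h => (this hy hx hpy hpx h).symm
  exfalso
  cases s with
  | zero => exact absurd rfl hs
  | pos =>
    have := hR.eval_lt_eval_of_mem_finsetGap (fun x hx => sign_eq_one_iff.1 (hp' x hx)) hx hy hxy
    simp [hpx, hpy] at this
  | neg =>
    have := hR.eval_lt_eval_of_mem_finsetGap (p := -p)
      (fun x hx => by simpa using sign_eq_neg_one_iff.1 (hp' x hx)) hx hy hxy
    simp [hpx, hpy] at this

end Comparison

section SignMatch

variable {R S : Type*} [Field R] [LinearOrder R] [IsStrictOrderedRing R]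
  [Field S] [LinearOrder S] [IsStrictOrderedRing S]

/-- The position of `x` relative to `Z` is the position of `y` relative to `f '' Z`. -/
def SamePosition {R S : Type*} [LT R] [LT S] (Z : Finset R) (f : R → S) (x : R) (y : S) : Prop :=
  ∀ z ∈ Z, (x < z ↔ y < f z) ∧ (z < x ↔ f z < y)

/-- The pairs of polynomials in `F` have the same sign at points having the same position relative
to `Z` and `f '' Z`. -/
def SignMatch (Z : Finset R) (f : R → S) (F : Set (R[X] × S[X])) : Prop :=
  StrictMonoOn f Z ∧ ∀ x y, SamePosition Z f x y → ∀ p ∈ F,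
    SignType.sign (p.1.eval x) = SignType.sign (p.2.eval y)

variable {Z : Finset R} {f : R → S} {x : R} {y : S} {F : Set (R[X] × S[X])}

theorem samePosition_self (hf : StrictMonoOn f Z) (hx : x ∈ Z) : SamePosition Z f x (f x) :=
  fun _ hz => ⟨(hf.lt_iff_lt hx hz).symm, (hf.lt_iff_lt hz hx).symm⟩

theorem SamePosition.eq_of_mem (h : SamePosition Z f x y) (hx : x ∈ Z) : y = f x := by
  have := h x hx
  simp only [lt_self_iff_false, false_iff, not_lt] at this
  exact le_antisymm this.2 this.1

theorem samePosition_iff_of_notMem (hx : x ∉ Z) :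
    SamePosition Z f x y ↔
      y ∈ finsetGap ((Z.filter (· < x)).image f) ((Z.filter (x < ·)).image f) := by
  simp only [finsetGap, Set.mem_ofPred_eq, Finset.forall_mem_image, Finset.mem_filter, and_imp,
    SamePosition]
  constructor
  · exact fun h => ⟨fun z hz hzx => (h z hz).2.1 hzx, fun z hz hzx => (h z hz).1.1 hzx⟩
  · intro h z hz
    rcases lt_trichotomy z x with hlt | rfl | hgt
    · have := h.1 hz hlt
      simp [hlt, this, hlt.not_gt, this.not_gt]
    · exact absurd hz hx
    · have := h.2 hz hgt
      simp [hgt, this, hgt.not_gt, this.not_gt]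

theorem samePosition_iff_of_mem_finsetGap (hx : x ∉ Z) {x' : R}
    (hx' : x' ∈ finsetGap (Z.filter (· < x)) (Z.filter (x < ·))) :
    x' ∉ Z ∧ (SamePosition Z f x' y ↔ SamePosition Z f x y) := by
  have hlt : ∀ z ∈ Z, (x' < z ↔ x < z) ∧ (z < x' ↔ z < x) := by
    intro z hz
    rcases lt_trichotomy z x with hlt | rfl | hgt
    · have := hx'.1 z (by simp [hz, hlt])
      simp [hlt, this, hlt.not_gt, this.not_gt]
    · exact absurd hz hx
    · have := hx'.2 z (by simp [hz, hgt])
      simp [hgt, this, hgt.not_gt, this.not_gt]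
  refine ⟨fun hmem => ?_, forall₂_congr fun z hz => by rw [(hlt z hz).1, (hlt z hz).2]⟩
  have h := hlt x' hmem
  simp only [lt_self_iff_false, false_iff, not_lt] at h
  exact hx (le_antisymm h.2 h.1 ▸ hmem)

theorem mem_finsetGap_filter (x : R) :
    x ∈ finsetGap (Z.filter (· < x)) (Z.filter (x < ·)) :=
  ⟨fun _ ha => (Finset.mem_filter.1 ha).2, fun _ hb => (Finset.mem_filter.1 hb).2⟩

theorem nonempty_finsetGap_image (hf : StrictMonoOn f Z) (x : R) :
    (finsetGap ((Z.filter (· < x)).image f) ((Z.filter (x < ·)).image f)).Nonempty := by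
  obtain ⟨y, hy, hy'⟩ := Order.exists_between_finsets ((Z.filter (· < x)).image f)
    ((Z.filter (x < ·)).image f) (by
      simp only [Finset.forall_mem_image, Finset.mem_filter]
      rintro a ⟨ha, hax⟩ b ⟨hb, hbx⟩
      exact hf ha hb (hax.trans hbx))
  exact ⟨y, hy, hy'⟩

theorem exists_samePosition (hf : StrictMonoOn f Z) (x : R) : ∃ y, SamePosition Z f x y := by
  by_cases hx : x ∈ Z
  · exact ⟨f x, samePosition_self hf hx⟩
  · obtain ⟨y, hy⟩ := nonempty_finsetGap_image hf x
    exact ⟨y, (samePosition_iff_of_notMem hx).2 hy⟩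

theorem exists_samePosition' (hf : StrictMonoOn f Z) (y : S) : ∃ x, SamePosition Z f x y := by
  by_cases hy : ∃ z ∈ Z, f z = y
  · obtain ⟨z, hz, rfl⟩ := hy
    exact ⟨z, samePosition_self hf hz⟩
  · push Not at hy
    obtain ⟨x, hx, hx'⟩ := Order.exists_between_finsets (Z.filter (f · < y)) (Z.filter (y < f ·)) (by
      simp only [Finset.mem_filter]
      rintro a ⟨ha, hax⟩ b ⟨hb, hbx⟩
      exact (hf.lt_iff_lt ha hb).1 (hax.trans hbx))
    refine ⟨x, fun z hz => ?_⟩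
    rcases lt_trichotomy (f z) y with hlt | h | hgt
    · have := hx z (by simp [hz, hlt])
      simp [hlt, this, hlt.not_gt, this.not_gt]
    · exact absurd h (hy z hz)
    · have := hx' z (by simp [hz, hgt])
      simp [hgt, this, hgt.not_gt, this.not_gt]

/-- A sign matching of `F` gives one of any subset `G` whose marked points are the roots of the
nonzero polynomials of `G`. -/
theorem SignMatch.exists_subset (hS : PolyIVT S) (h : SignMatch Z f F)
    {G : Set (R[X] × S[X])} (hGF : G ⊆ F) (hG : ∀ p ∈ G, p.1 = 0 ↔ p.2 = 0) :
    ∃ Z' ⊆ Z, SignMatch Z' f G ∧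
      ∀ x, x ∈ Z' ↔ ∃ p ∈ G, p.1 ≠ 0 ∧ p.1.eval x = 0 := by
  classical
  obtain ⟨hf, hF⟩ := h
  have hmem : ∀ x, ∀ p ∈ G, p.1 ≠ 0 → p.1.eval x = 0 → x ∈ Z := by
    intro x p hp hp0 hx
    by_contra hxZ
    refine hp0 ((hG p hp).2 (p.2.eq_zero_of_infinite_isRoot
      ((infinite_finsetGap (nonempty_finsetGap_image hf x)).mono fun y hy => ?_)))
    have := hF x y ((samePosition_iff_of_notMem hxZ).2 hy) p (hGF hp)
    rw [hx, sign_zero, eq_comm, sign_eq_zero_iff] at this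
    exact this
  set Z' := Z.filter fun x => ∃ p ∈ G, p.1 ≠ 0 ∧ p.1.eval x = 0 with hZ'
  have hZ'mem : ∀ x, x ∈ Z' ↔ ∃ p ∈ G, p.1 ≠ 0 ∧ p.1.eval x = 0 := by
    intro x
    simp only [hZ', Finset.mem_filter, and_iff_right_iff_imp]
    rintro ⟨p, hp, hp0, hx⟩
    exact hmem x p hp hp0 hx
  have hsub : Z' ⊆ Z := Finset.filter_subset _ _
  have hf' : StrictMonoOn f Z' := hf.mono (by exact_mod_cast hsub)
  refine ⟨Z', hsub, ⟨hf', fun x y hxy p hp => ?_⟩, hZ'mem⟩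
  by_cases hp0 : p.1 = 0
  · rw [hp0, (hG p hp).1 hp0]
    simp
  by_cases hx : x ∈ Z'
  · rw [hxy.eq_of_mem hx]
    exact hF x _ (samePosition_self hf (hsub hx)) p (hGF hp)
  have hy := (samePosition_iff_of_notMem hx).1 hxy
  obtain ⟨y', hy'⟩ := exists_samePosition hf x
  have hy'' := (samePosition_iff_of_notMem hx).1 (fun z hz => hy' z (hsub hz))
  rw [hF x y' hy' p (hGF hp)]
  refine hS.sign_eval_eq ordConnected_finsetGap (fun η hη hη0 => ?_) hy'' hy
  obtain ⟨ξ, hξ⟩ := exists_samePosition' hf η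
  have hξ0 := hF ξ η hξ p (hGF hp)
  rw [hη0, sign_zero, sign_eq_zero_iff] at hξ0
  have hξZ : ξ ∈ Z' := (hZ'mem ξ).2 ⟨p, hp, hp0, hξ0⟩
  have h1 : SamePosition Z' f x η := (samePosition_iff_of_notMem hx).2 hη
  have h2 := h1 ξ hξZ
  rw [hξ.eq_of_mem (hsub hξZ)] at h2
  simp only [lt_self_iff_false, iff_false, not_lt] at h2
  exact hx (le_antisymm h2.2 h2.1 ▸ hξZ)

theorem SignMatch.exists_insert (hR : PolyIVT R) (hS : PolyIVT S) (h : SignMatch Z f F)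
    {p : R[X]} {q : S[X]} (hp : 0 < p.natDegree) (hq : 0 < q.natDegree)
    (hpq : (p.derivative, q.derivative) ∈ F) (hZ : ∀ x, p.derivative.eval x = 0 → x ∈ Z)
    (hsign : ∀ z ∈ Z, SignType.sign (p.eval z) = SignType.sign (q.eval (f z))) :
    ∃ (Z' : Finset R) (f' : R → S), SignMatch Z' f' (insert (p, q) F) := by
  classical
  obtain ⟨hf, hF⟩ := h
  have hgapR : ∀ x ∉ Z, ∀ x' ∈ finsetGap (Z.filter (· < x)) (Z.filter (x < ·)),
      SignType.sign (p.derivative.eval x') = SignType.sign (p.derivative.eval x) := by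
    intro x hx x' hx'
    obtain ⟨y, hy⟩ := exists_samePosition hf x
    rw [hF x y hy _ hpq]
    exact hF x' y ((samePosition_iff_of_mem_finsetGap hx hx').2.2 hy) _ hpq
  have hgapS : ∀ x ∉ Z, ∀ y ∈ finsetGap ((Z.filter (· < x)).image f) ((Z.filter (x < ·)).image f),
      SignType.sign (q.derivative.eval y) = SignType.sign (p.derivative.eval x) := fun x hx y hy =>
    (hF x y ((samePosition_iff_of_notMem hx).2 hy) _ hpq).symm
  have hne : ∀ x ∉ Z, SignType.sign (p.derivative.eval x) ≠ 0 := fun x hx h0 =>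
    hx (hZ x (sign_eq_zero_iff.1 h0))
  have hcomp := fun x (hx : x ∉ Z) => finsetGap_comparison hR hS (A := Z.filter (· < x))
    (B := Z.filter (x < ·)) (f := f)
    (fun a ha a' ha' => hf.le_iff_le (Finset.mem_filter.1 ha).1 (Finset.mem_filter.1 ha').1)
    (fun a ha a' ha' => hf.le_iff_le (Finset.mem_filter.1 ha).1 (Finset.mem_filter.1 ha').1)
    hp hq ⟨x, mem_finsetGap_filter x⟩ (nonempty_finsetGap_image hf x)
    (fun a ha => hsign a (Finset.mem_filter.1 ha).1) (fun a ha => hsign a (Finset.mem_filter.1 ha).1)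
    (hne x hx) (hgapR x hx) (hgapS x hx)
  have hroot : ∀ x, ∃ y, (x ∈ Z → y = f x) ∧
      (x ∉ Z → p.eval x = 0 → SamePosition Z f x y ∧ q.eval y = 0) := by
    intro x
    by_cases hx : x ∈ Z
    · exact ⟨f x, fun _ => rfl, fun h => absurd hx h⟩
    · by_cases hpx : p.eval x = 0
      · obtain ⟨y, hy, hy0⟩ := (hcomp x hx).1 ⟨x, mem_finsetGap_filter x, hpx⟩
        exact ⟨y, fun h => absurd h hx, fun _ _ => ⟨(samePosition_iff_of_notMem hx).2 hy, hy0⟩⟩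
      · exact ⟨0, fun h => absurd h hx, fun _ h => absurd h hpx⟩
  choose f' hf'Z hf'p using hroot
  have hp0 : p ≠ 0 := fun h => by simp [h] at hp
  have hmem : ∀ x, x ∈ Z ∪ p.roots.toFinset ↔ x ∈ Z ∨ p.eval x = 0 := by
    intro x
    simp [hp0]
  have hpos : ∀ x ∈ Z ∪ p.roots.toFinset, SamePosition Z f x (f' x) := by
    intro x hx
    by_cases hxZ : x ∈ Z
    · rw [hf'Z x hxZ]
      exact samePosition_self hf hxZ
    · exact (hf'p x hxZ (((hmem x).1 hx).resolve_left hxZ)).1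
  have hmono : StrictMonoOn f' ↑(Z ∪ p.roots.toFinset) := by
    intro x hx w hw hxw
    by_cases hxZ : x ∈ Z
    · rw [hf'Z x hxZ]
      exact ((hpos w hw) x hxZ).2.1 hxw
    by_cases hwZ : w ∈ Z
    · rw [hf'Z w hwZ]
      exact ((hpos x hx) w hwZ).1.1 hxw
    by_cases hc : ∃ c ∈ Z, x < c ∧ c < w
    · obtain ⟨c, hc, hxc, hcw⟩ := hc
      exact (((hpos x hx) c hc).1.1 hxc).trans (((hpos w hw) c hc).2.1 hcw)
    · push Not at hc
      refine absurd ?_ hxw.ne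
      refine hR.eq_of_eval_eq_zero (hne x hxZ) (hgapR x hxZ) (mem_finsetGap_filter x) ⟨?_, ?_⟩
        (((hmem x).1 hx).resolve_left hxZ) (((hmem w).1 hw).resolve_left hwZ)
      · exact fun a ha => (Finset.mem_filter.1 ha).2.trans hxw
      · intro b hb
        rw [Finset.mem_filter] at hb
        exact (hc b hb.1 hb.2).lt_of_ne fun h => hwZ (h ▸ hb.1)
  refine ⟨Z ∪ p.roots.toFinset, f', hmono, fun x y hxy r hr => ?_⟩
  have hxyZ : SamePosition Z f x y := fun z hz => by
    rw [← hf'Z z hz]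
    exact hxy z (Finset.mem_union_left _ hz)
  rcases hr with rfl | hr
  swap
  · exact hF x y hxyZ r hr
  by_cases hxZ : x ∈ Z
  · rw [hxyZ.eq_of_mem hxZ]
    exact hsign x hxZ
  by_cases hxp : p.eval x = 0
  · rw [hxy.eq_of_mem ((hmem x).2 (Or.inr hxp))]
    simp only [hxp, (hf'p x hxZ hxp).2, sign_zero]
  refine (hcomp x hxZ).2 x (mem_finsetGap_filter x) y ((samePosition_iff_of_notMem hxZ).1 hxyZ)
    fun ρ hρ η hη hρ0 hη0 => ?_
  obtain ⟨hρZ, hρiff⟩ := samePosition_iff_of_mem_finsetGap (y := f' ρ) hxZ hρ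
  have hρ' := hf'p ρ hρZ hρ0
  have : f' ρ = η := hS.eq_of_eval_eq_zero (hne x hxZ) (hgapS x hxZ)
    ((samePosition_iff_of_notMem hxZ).1 (hρiff.1 hρ'.1)) hη hρ'.2 hη0
  rw [← this]
  exact hxy ρ ((hmem ρ).2 (Or.inr hρ0))

end SignMatch

theorem Polynomial.exists_C_pow_mul_eq_mul_add {D : Type*} [CommRing D] {a : D[X]}
    (ha : 0 < a.natDegree) (p : D[X]) :
    ∃ (k : ℕ) (u r : D[X]), C (a.leadingCoeff ^ k) * p = a * u + r ∧ r.natDegree < a.natDegree := by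
  induction hd : p.natDegree using Nat.strong_induction_on generalizing p with
  | _ d ih =>
  by_cases hlt : p.natDegree < a.natDegree
  · exact ⟨0, 0, p, by simp, hlt⟩
  push Not at hlt
  set p' : D[X] := C a.leadingCoeff * p - a * (C p.leadingCoeff * X ^ (p.natDegree - a.natDegree))
    with hp'
  have hlt' : p'.natDegree < p.natDegree := by
    have hle : p'.natDegree ≤ p.natDegree := by
      refine (natDegree_sub_le _ _).trans (max_le (natDegree_C_mul_le _ _) ?_)
      refine natDegree_mul_le.trans ?_
      have := natDegree_C_mul_X_pow_le p.leadingCoeff (p.natDegree - a.natDegree)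
      omega
    refine lt_of_le_of_ne hle fun heq => ?_
    have hcoeff : p'.coeff p.natDegree = 0 := by
      rw [hp', coeff_sub, coeff_C_mul, ← mul_assoc, coeff_mul_X_pow', if_pos (Nat.sub_le _ _),
        Nat.sub_sub_self hlt, coeff_mul_C, leadingCoeff, leadingCoeff, sub_self]
    rw [← heq, coeff_natDegree, leadingCoeff_eq_zero] at hcoeff
    rw [hcoeff, natDegree_zero] at heq
    omega
  obtain ⟨k, u, r, h, hr⟩ := ih _ (hd ▸ hlt') p' rfl
  refine ⟨k + 1, u + C (a.leadingCoeff ^ k) * (C p.leadingCoeff * X ^ (p.natDegree - a.natDegree)), r,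
    ?_, hr⟩
  rw [mul_add, add_right_comm, ← h, hp', pow_succ, C_mul]
  ring

section Transfer

variable {D R S : Type*} [CommRing D] [Field R] [LinearOrder R] [IsStrictOrderedRing R]
  [Field S] [LinearOrder S] [IsStrictOrderedRing S]

/-- The filter of ring homomorphisms to `S` having the same signs as `φ` on finite sets. -/
def signFilter (S : Type*) [Field S] [LinearOrder S] (φ : D →+* R) : Filter (D →+* S) :=
  ⨅ d, Filter.principal {ψ | SignType.sign (ψ d) = SignType.sign (φ d)}

theorem eventually_sign_eq (φ : D →+* R) (d : D) :
    ∀ᶠ ψ in signFilter S φ, SignType.sign (ψ d) = SignType.sign (φ d) :=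
  Filter.mem_iInf_of_mem d (Filter.mem_principal_self _)

theorem eventually_eq_zero_iff (φ : D →+* R) (d : D) :
    ∀ᶠ ψ in signFilter S φ, ψ d = 0 ↔ φ d = 0 :=
  (eventually_sign_eq φ d).mono fun ψ h => by
    rw [← sign_eq_zero_iff, h, sign_eq_zero_iff]

theorem signFilter_neBot_iff {φ : D →+* R} :
    (signFilter S φ).NeBot ↔
      ∀ F : Finset D, ∃ ψ : D →+* S, ∀ d ∈ F, SignType.sign (ψ d) = SignType.sign (φ d) := by
  rw [signFilter, (Filter.hasBasis_iInf_principal_finite _).neBot_iff]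
  constructor
  · intro h F
    obtain ⟨ψ, hψ⟩ := h F.finite_toSet
    exact ⟨ψ, by simpa using hψ⟩
  · intro h F hF
    obtain ⟨ψ, hψ⟩ := h hF.toFinset
    exact ⟨ψ, by simpa using hψ⟩

theorem eventually_support_map_eq (φ : D →+* R) (a : D[X]) :
    ∀ᶠ ψ in signFilter S φ, (a.map ψ).support = (a.map φ).support := by
  have : ∀ᶠ ψ in signFilter S φ, ∀ i ∈ a.support, ψ (a.coeff i) = 0 ↔ φ (a.coeff i) = 0 :=
    (Filter.eventually_all_finset _).2 fun i _ => eventually_eq_zero_iff φ _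
  filter_upwards [this] with ψ hψ
  ext i
  rw [mem_support_iff, mem_support_iff, coeff_map, coeff_map, not_iff_not]
  by_cases hi : i ∈ a.support
  · exact hψ i hi
  · rw [notMem_support_iff.1 hi, map_zero, map_zero]
    simp

theorem Polynomial.natDegree_eq_of_support_eq {R S : Type*} [Semiring R] [Semiring S] {p : R[X]}
    {q : S[X]} (h : p.support = q.support) : p.natDegree = q.natDegree := by
  rw [natDegree, natDegree, degree, degree, h]

theorem eventually_natDegree_map_eq (φ : D →+* R) (a : D[X]) :
    ∀ᶠ ψ in signFilter S φ, (a.map ψ).natDegree = (a.map φ).natDegree :=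
  (eventually_support_map_eq φ a).mono fun _ => natDegree_eq_of_support_eq

theorem eventually_map_eq_zero_iff (φ : D →+* R) (a : D[X]) :
    ∀ᶠ ψ in signFilter S φ, a.map φ = 0 ↔ a.map ψ = 0 :=
  (eventually_support_map_eq φ a).mono fun _ h => by
    rw [← support_eq_empty, ← h, support_eq_empty]

theorem exists_map_eq_and_eventually (φ : D →+* R) (a : D[X]) (ha : 0 < (a.map φ).natDegree) :
    ∃ b : D[X], b.map φ = a.map φ ∧ (∀ᶠ ψ in signFilter S φ, b.map ψ = a.map ψ) ∧
      φ b.leadingCoeff ≠ 0 := by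
  classical
  set b : D[X] := ∑ i ∈ (a.map φ).support, monomial i (a.coeff i) with hb
  have hcoeff : ∀ i, b.coeff i = if i ∈ (a.map φ).support then a.coeff i else 0 := by
    intro i
    simp [hb, coeff_monomial]
  have hmap : b.map φ = a.map φ := by
    ext i
    rw [coeff_map, hcoeff, coeff_map]
    split_ifs with hi
    · rfl
    · rw [map_zero, ← coeff_map, notMem_support_iff.1 hi]
  refine ⟨b, hmap, ?_, ?_⟩
  · filter_upwards [eventually_support_map_eq φ a] with ψ hψ
    ext i
    rw [coeff_map, hcoeff, coeff_map]
    split_ifs with hi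
    · rfl
    · rw [map_zero, ← coeff_map, notMem_support_iff.1 (hψ ▸ hi)]
  · have hb0 : b ≠ 0 := fun h => by simp [← hmap, h] at ha
    have := hcoeff b.natDegree
    rw [coeff_natDegree] at this
    by_cases hi : b.natDegree ∈ (a.map φ).support
    · rw [if_pos hi] at this
      rwa [this, ← coeff_map, ← mem_support_iff]
    · rw [if_neg hi, leadingCoeff_eq_zero] at this
      exact absurd this hb0

theorem exists_eventually_mul_eq_mul_add (φ : D →+* R) (a : D[X]) (ha : 0 < (a.map φ).natDegree)
    (p : D[X]) : ∃ (c : D) (u r : D[X]), 0 < φ c ∧ (r.map φ).natDegree < (a.map φ).natDegree ∧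
      C (φ c) * p.map φ = a.map φ * u.map φ + r.map φ ∧
      ∀ᶠ ψ in signFilter S φ, C (ψ c) * p.map ψ = a.map ψ * u.map ψ + r.map ψ := by
  obtain ⟨b, hbφ, hbψ, hb⟩ := exists_map_eq_and_eventually (S := S) φ a ha
  have hdeg : (a.map φ).natDegree = b.natDegree := by
    rw [← hbφ, natDegree_map_of_leadingCoeff_ne_zero _ hb]
  obtain ⟨k, u, r, h, hr⟩ := exists_C_pow_mul_eq_mul_add (hdeg ▸ ha) p
  have key : C ((b.leadingCoeff ^ k) ^ 2) * p =
      b * (C (b.leadingCoeff ^ k) * u) + C (b.leadingCoeff ^ k) * r := by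
    rw [pow_two, C_mul, mul_assoc, h]
    ring
  refine ⟨(b.leadingCoeff ^ k) ^ 2, C (b.leadingCoeff ^ k) * u, C (b.leadingCoeff ^ k) * r,
    ?_, ?_, ?_, ?_⟩
  · rw [map_pow, map_pow]
    positivity
  · rw [hdeg]
    exact natDegree_map_le.trans_lt ((natDegree_C_mul_le _ _).trans_lt hr)
  · have := congrArg (Polynomial.map φ) key
    simpa only [Polynomial.map_add, Polynomial.map_mul, map_C, hbφ] using this
  · filter_upwards [hbψ] with ψ hψ
    have := congrArg (Polynomial.map ψ) key
    simpa only [Polynomial.map_add, Polynomial.map_mul, map_C, hψ] using this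

theorem eventually_signMatch_insert (hR : PolyIVT R) (hS : PolyIVT S) (φ : D →+* R) (p : D[X])
    (hp : 0 < (p.map φ).natDegree) (G : Finset D[X]) (hpG : derivative p ∈ G)
    (r : D[X] → D[X]) (c : D[X] → D) (u : D[X] → D[X])
    (hr : ∀ a ∈ G, 0 < (a.map φ).natDegree →
      0 < φ (c a) ∧ C (φ (c a)) * p.map φ = a.map φ * (u a).map φ + (r a).map φ ∧
      ∀ᶠ ψ in signFilter S φ, C (ψ (c a)) * p.map ψ = a.map ψ * (u a).map ψ + (r a).map ψ)
    (F : Set D[X]) (hGF : ↑G ⊆ F) (hrF : ∀ a ∈ G, 0 < (a.map φ).natDegree → r a ∈ F)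
    (h : ∀ᶠ ψ in signFilter S φ, ∃ (Z : Finset R) (f : R → S),
      SignMatch Z f ((fun a : D[X] => (a.map φ, a.map ψ)) '' F)) :
    ∀ᶠ ψ in signFilter S φ, ∃ (Z : Finset R) (f : R → S),
      SignMatch Z f ((fun a : D[X] => (a.map φ, a.map ψ)) '' (insert p ↑G)) := by
  have h1 : ∀ᶠ ψ in signFilter S φ, ∀ a ∈ G, a.map φ = 0 ↔ a.map ψ = 0 :=
    (Filter.eventually_all_finset _).2 fun a _ => eventually_map_eq_zero_iff φ a
  have h2 : ∀ᶠ ψ in signFilter S φ, ∀ a ∈ G, 0 < (a.map φ).natDegree →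
      (0 < ψ (c a) ∧ C (ψ (c a)) * p.map ψ = a.map ψ * (u a).map ψ + (r a).map ψ) := by
    refine (Filter.eventually_all_finset _).2 fun a ha => Filter.eventually_all.2 fun hd => ?_
    obtain ⟨hc, -, hev⟩ := hr a ha hd
    filter_upwards [hev, eventually_sign_eq φ (c a)] with ψ h1 h2
    rw [sign_pos hc, sign_eq_one_iff] at h2
    exact ⟨h2, h1⟩
  filter_upwards [h, h1, h2, eventually_natDegree_map_eq φ p] with ψ ⟨Z, f, hZ⟩ h1 h2 h3
  obtain ⟨Z', hZZ', hZ', hmem⟩ := hZ.exists_subset hS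
    (G := (fun a : D[X] => (a.map φ, a.map ψ)) '' ↑G) (Set.image_mono hGF) (by
      rintro _ ⟨a, ha, rfl⟩
      exact h1 a ha)
  obtain ⟨Z'', f'', hres⟩ := hZ'.exists_insert hR hS (p := p.map φ) (q := p.map ψ) hp (h3 ▸ hp)
    ⟨derivative p, hpG, by simp only [derivative_map]⟩ (fun x hx => (hmem x).2
      ⟨_, ⟨derivative p, hpG, rfl⟩, by
        simp only
        rw [← derivative_map]
        intro h0
        have := derivative_eq_zero.1 h0
        omega, by simpa only [derivative_map] using hx⟩) (by
      intro z hz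
      obtain ⟨_, ⟨a, ha, rfl⟩, ha0, hz0⟩ := (hmem z).1 hz
      simp only at ha0 hz0
      have hdeg : 0 < (a.map φ).natDegree := by
        by_contra! hd
        rw [eq_C_of_natDegree_le_zero hd, eval_C] at hz0
        rw [eq_C_of_natDegree_le_zero hd, hz0, C_0] at ha0
        exact ha0 rfl
      obtain ⟨hc, hφ, -⟩ := hr a ha hdeg
      obtain ⟨hc', hψ⟩ := h2 a ha hdeg
      have hself := samePosition_self hZ.1 (hZZ' hz)
      have hψ0 := hZ.2 z _ hself _ ⟨a, hGF ha, rfl⟩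
      have hrs := hZ.2 z _ hself _ ⟨r a, hrF a ha hdeg, rfl⟩
      simp only at hψ0 hrs
      rw [hz0, sign_zero, eq_comm, sign_eq_zero_iff] at hψ0
      have e1 := congrArg (eval z) hφ
      have e2 := congrArg (eval (f z)) hψ
      rw [eval_mul, eval_C, eval_add, eval_mul, hz0, zero_mul, zero_add] at e1
      rw [eval_mul, eval_C, eval_add, eval_mul, hψ0, zero_mul, zero_add] at e2
      rw [← e1, ← e2, sign_mul, sign_mul, sign_pos hc, sign_pos hc', one_mul, one_mul] at hrs
      exact hrs)
  exact ⟨Z'', f'', by rwa [Set.image_insert_eq]⟩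

theorem SignMatch.mono {Z : Finset R} {f : R → S} {F G : Set (R[X] × S[X])} (h : SignMatch Z f F)
    (hGF : G ⊆ F) : SignMatch Z f G :=
  ⟨h.1, fun x y hxy p hp => h.2 x y hxy p (hGF hp)⟩

theorem eventually_signMatch (hR : PolyIVT R) (hS : PolyIVT S) (φ : D →+* R) (F : Finset D[X]) :
    ∀ᶠ ψ in signFilter S φ, ∃ (Z : Finset R) (f : R → S),
      SignMatch Z f ((fun a : D[X] => (a.map φ, a.map ψ)) '' ↑F) := by
  classical
  suffices H : ∀ (d : ℕ) (F : Finset D[X]), (∀ a ∈ F, (a.map φ).natDegree ≤ d) →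
      ∀ᶠ ψ in signFilter S φ, ∃ (Z : Finset R) (f : R → S),
        SignMatch Z f ((fun a : D[X] => (a.map φ, a.map ψ)) '' ↑F) from
    H (F.sup fun a => (a.map φ).natDegree) F fun a ha =>
      Finset.le_sup (f := fun a : D[X] => (a.map φ).natDegree) ha
  intro d
  induction d with
  | zero =>
    intro F hF
    have : ∀ᶠ ψ in signFilter S φ, ∀ a ∈ F, (a.map ψ).natDegree = 0 ∧
        SignType.sign (ψ (a.coeff 0)) = SignType.sign (φ (a.coeff 0)) := by
      refine (Filter.eventually_all_finset _).2 fun a ha => ?_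
      filter_upwards [eventually_natDegree_map_eq φ a, eventually_sign_eq φ (a.coeff 0)] with ψ h1 h2
      exact ⟨h1.trans (Nat.le_zero.1 (hF a ha)), h2⟩
    filter_upwards [this] with ψ hψ
    refine ⟨∅, fun _ => 0, by simp [StrictMonoOn], fun x y _ => ?_⟩
    rintro _ ⟨a, ha, rfl⟩
    simp only
    rw [eq_C_of_natDegree_eq_zero (hψ a ha).1, eq_C_of_natDegree_le_zero (hF a ha), eval_C, eval_C,
      coeff_map, coeff_map, (hψ a ha).2]
  | succ d ih =>
    suffices H : ∀ (H : Finset D[X]), (∀ a ∈ H, (a.map φ).natDegree = d + 1) → ∀ L : Finset D[X],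
        (∀ a ∈ L, (a.map φ).natDegree ≤ d) → ∀ᶠ ψ in signFilter S φ, ∃ (Z : Finset R) (f : R → S),
          SignMatch Z f ((fun a : D[X] => (a.map φ, a.map ψ)) '' ↑(H ∪ L)) by
      intro F hF
      have := H (F.filter fun a => (a.map φ).natDegree = d + 1) (by simp)
        (F.filter fun a => ¬ (a.map φ).natDegree = d + 1) (by
          simp only [Finset.mem_filter]
          rintro a ⟨ha, ha'⟩
          have := hF a ha
          omega)
      rwa [Finset.filter_union_filter_not_eq] at this
    intro H
    induction H using Finset.induction_on with
    | empty =>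
      intro _ L hL
      simpa using ih L hL
    | insert p H hpH ihH =>
      intro hH L hL
      have hpdeg : (p.map φ).natDegree = d + 1 := hH p (Finset.mem_insert_self _ _)
      have hdiv : ∀ a : D[X], ∃ (c : D) (u r : D[X]), 0 < (a.map φ).natDegree →
          0 < φ c ∧ (r.map φ).natDegree < (a.map φ).natDegree ∧
          C (φ c) * p.map φ = a.map φ * u.map φ + r.map φ ∧
          ∀ᶠ ψ in signFilter S φ, C (ψ c) * p.map ψ = a.map ψ * u.map ψ + r.map ψ := by
        intro a
        by_cases ha : 0 < (a.map φ).natDegree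
        · obtain ⟨c, u, r, h⟩ := exists_eventually_mul_eq_mul_add (S := S) φ a ha p
          exact ⟨c, u, r, fun _ => h⟩
        · exact ⟨0, 0, 0, fun h => absurd h ha⟩
      choose c u r hcur using hdiv
      set G : Finset D[X] := H ∪ insert (derivative p) L with hG
      have hL' : ∀ a ∈ insert (derivative p) L, (a.map φ).natDegree ≤ d := by
        intro a ha
        rcases Finset.mem_insert.1 ha with rfl | ha
        · rw [← derivative_map]
          exact (natDegree_derivative_le _).trans (by omega)
        · exact hL a ha
      have hGdeg : ∀ a ∈ G, (a.map φ).natDegree ≤ d + 1 := by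
        intro a ha
        rcases Finset.mem_union.1 ha with ha | ha
        · exact (hH a (Finset.mem_insert_of_mem ha)).le
        · exact (hL' a ha).trans (Nat.le_succ d)
      have key := ihH (fun a ha => hH a (Finset.mem_insert_of_mem ha))
        (insert (derivative p) L ∪ (G.filter fun a => 0 < (a.map φ).natDegree).image r) (by
          intro a ha
          rcases Finset.mem_union.1 ha with ha | ha
          · exact hL' a ha
          · obtain ⟨b, hb, rfl⟩ := Finset.mem_image.1 ha
            rw [Finset.mem_filter] at hb
            have := (hcur b hb.2).2.1
            have := hGdeg b hb.1
            omega)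
      have := eventually_signMatch_insert hR hS φ p (by omega) G (by simp [hG]) r c u
        (fun a _ hd => ⟨(hcur a hd).1, (hcur a hd).2.2⟩) _
        (by
          rw [← Finset.union_assoc, Finset.coe_union (H ∪ _)]
          exact Set.subset_union_left)
        (fun a ha hd => by
          simp only [Finset.coe_union, Set.mem_union, Finset.mem_coe, Finset.mem_image,
            Finset.mem_filter]
          exact Or.inr (Or.inr ⟨a, ⟨ha, hd⟩, rfl⟩)) key
      filter_upwards [this] with ψ ⟨Z, f, hZ⟩
      refine ⟨Z, f, hZ.mono (Set.image_mono ?_)⟩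
      intro a
      simp only [hG, Finset.coe_union, Finset.coe_insert, Set.mem_union, Set.mem_insert_iff,
        Finset.mem_coe]
      tauto

theorem signFilter_neBot_of_comp_C (hR : PolyIVT R) (hS : PolyIVT S) (Φ : D[X] →+* R)
    (h : (signFilter S (Φ.comp C)).NeBot) : (signFilter S Φ).NeBot := by
  rw [signFilter_neBot_iff]
  intro F
  obtain ⟨ψ, Z, f, hZ⟩ := (eventually_signMatch hR hS (Φ.comp C) F).exists
  obtain ⟨y, hy⟩ := exists_samePosition hZ.1 (Φ X)
  refine ⟨eval₂RingHom ψ y, fun a ha => ?_⟩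
  have := hZ.2 _ y hy _ ⟨a, ha, rfl⟩
  have hΦ : eval₂ (Φ.comp C) (Φ X) a = Φ a := by
    rw [← hom_eval₂, eval₂_C_X]
  simp only [eval_map] at this
  rw [coe_eval₂RingHom, ← this, hΦ]

theorem signFilter_comp_ringEquiv_neBot {D' : Type*} [CommRing D'] (e : D' ≃+* D) (φ : D →+* R)
    (h : (signFilter S φ).NeBot) : (signFilter S (φ.comp (e : D' →+* D))).NeBot := by
  classical
  rw [signFilter_neBot_iff] at h ⊢
  intro F
  obtain ⟨ψ, hψ⟩ := h (F.image e)
  exact ⟨ψ.comp (e : D' →+* D), fun d hd => by simpa using hψ (e d) (Finset.mem_image_of_mem _ hd)⟩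

end Transfer

theorem polyIVT_real : PolyIVT ℝ := by
  intro f a b hab ha hb
  exact intermediate_value_Ioo hab.le f.continuous.continuousOn ⟨ha, hb⟩

theorem signFilter_mvPolynomial_neBot {R : Type*} [Field R] [LinearOrder R] [IsStrictOrderedRing R]
    (hR : PolyIVT R) (n : ℕ) (φ : MvPolynomial (Fin n) ℝ →+* R) : (signFilter ℝ φ).NeBot := by
  induction n with
  | zero =>
    rw [signFilter_neBot_iff]
    refine fun F => ⟨MvPolynomial.eval Fin.elim0, fun a _ => ?_⟩
    obtain ⟨c, rfl⟩ := MvPolynomial.C_surjective (Fin 0) a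
    rw [MvPolynomial.eval_C]
    have hmono : StrictMono (φ.comp MvPolynomial.C : ℝ →+* R) := by
      refine (Monotone.strictMono_of_injective (fun a b hab => ?_) (RingHom.injective _))
      rw [← sub_nonneg, ← map_sub, ← Real.sq_sqrt (sub_nonneg.2 hab), map_pow]
      positivity
    exact (StrictMono.sign_comp (f := (φ.comp MvPolynomial.C : ℝ →+* R)) hmono c).symm
  | succ n ih =>
    let e := (MvPolynomial.finSuccEquiv ℝ n).toRingEquiv
    have := signFilter_comp_ringEquiv_neBot e (φ.comp (e.symm : _ →+* _))
      (signFilter_neBot_of_comp_C hR polyIVT_real _ (ih _))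
    convert this
    ext a <;> simp

/-- Transfer of finitely many sign conditions to real points. -/
theorem MvPolynomial.exists_sign_eval_eq {R : Type*} [Field R] [LinearOrder R]
    [IsStrictOrderedRing R] (hR : PolyIVT R) {n : ℕ} (φ : MvPolynomial (Fin n) ℝ →+* R)
    (F : Finset (MvPolynomial (Fin n) ℝ)) :
    ∃ x : Fin n → ℝ, ∀ a ∈ F, SignType.sign (MvPolynomial.eval x a) = SignType.sign (φ a) := by
  obtain ⟨ψ, hψ⟩ := signFilter_neBot_iff.1 (signFilter_mvPolynomial_neBot hR n φ) F
  refine ⟨fun i => ψ (MvPolynomial.X i), fun a ha => ?_⟩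
  have : ψ = MvPolynomial.eval fun i => ψ (MvPolynomial.X i) := by
    refine MvPolynomial.ringHom_ext (fun r => ?_) fun i => by simp
    rw [MvPolynomial.eval_C]
    exact RingHom.congr_fun (Subsingleton.elim (ψ.comp MvPolynomial.C) (RingHom.id ℝ)) r
  rw [← this, hψ a ha]

section SignChange

variable {E : Type*} [Field E] [LinearOrder E] [IsStrictOrderedRing E]

/-- The sums of squares of polynomials with nonnegative coefficients. -/
noncomputable def weightedSumSq (E : Type*) [Field E] [LinearOrder E] : AddSubmonoid E[X] :=
  AddSubmonoid.closure {p | ∃ (q : E) (h : E[X]), 0 ≤ q ∧ p = C q * h ^ 2}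

theorem C_mul_sq_mem_weightedSumSq {q : E} (hq : 0 ≤ q) (h : E[X]) :
    C q * h ^ 2 ∈ weightedSumSq E :=
  AddSubmonoid.subset_closure ⟨q, h, hq, rfl⟩

theorem sq_mem_weightedSumSq (h : E[X]) : h ^ 2 ∈ weightedSumSq E := by
  simpa using C_mul_sq_mem_weightedSumSq zero_le_one h

theorem mul_mem_weightedSumSq {s t : E[X]} (hs : s ∈ weightedSumSq E) (ht : t ∈ weightedSumSq E) :
    s * t ∈ weightedSumSq E := by
  refine AddSubmonoid.closure_induction (fun s hs => ?_) (by simp) (fun a b _ _ ha hb => ?_) hs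
  · obtain ⟨q, h, hq, rfl⟩ := hs
    refine AddSubmonoid.closure_induction (fun t ht => ?_) (by simp) (fun a b _ _ ha hb => ?_) ht
    · obtain ⟨q', h', hq', rfl⟩ := ht
      have := C_mul_sq_mem_weightedSumSq (mul_nonneg hq hq') (h * h')
      rw [C_mul] at this
      convert this using 1
      ring
    · rw [mul_add]
      exact add_mem ha hb
  · rw [add_mul]
    exact add_mem ha hb

theorem eval_nonneg_of_mem_weightedSumSq {s : E[X]} (hs : s ∈ weightedSumSq E) (x : E) :
    0 ≤ s.eval x := by
  refine AddSubmonoid.closure_induction (fun s hs => ?_) (by simp) (fun a b _ _ ha hb => ?_) hs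
  · obtain ⟨q, h, hq, rfl⟩ := hs
    rw [eval_mul, eval_C, eval_pow]
    positivity
  · rw [eval_add]
    exact add_nonneg ha hb

theorem exists_mem_weightedSumSq_natDegree_le {f : E[X]} (hf : 0 < f.natDegree) {s : E[X]}
    (hs : s ∈ weightedSumSq E) :
    ∃ s' ∈ weightedSumSq E, s'.natDegree ≤ 2 * (f.natDegree - 1) ∧ f ∣ s - s' := by
  refine AddSubmonoid.closure_induction (fun s hs => ?_) ⟨0, zero_mem _, by simp⟩
    (fun a b _ _ ha hb => ?_) hs
  · obtain ⟨q, h, hq, rfl⟩ := hs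
    refine ⟨C q * (h % f) ^ 2, C_mul_sq_mem_weightedSumSq hq _, ?_, ?_⟩
    · refine (natDegree_C_mul_le _ _).trans (natDegree_pow_le.trans ?_)
      have := natDegree_mod_lt h hf.ne'
      gcongr
      omega
    · have : f ∣ h - h % f := ⟨h / f, by rw [sub_eq_iff_eq_add, EuclideanDomain.div_add_mod]⟩
      rw [show C q * h ^ 2 - C q * (h % f) ^ 2 = (h - h % f) * (C q * (h + h % f)) by ring]
      exact this.mul_right _
  · obtain ⟨a', ha', had, hfa⟩ := ha
    obtain ⟨b', hb', hbd, hfb⟩ := hb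
    refine ⟨a' + b', add_mem ha' hb', (natDegree_add_le _ _).trans (max_le had hbd), ?_⟩
    rw [add_sub_add_comm]
    exact dvd_add hfa hfb

theorem exists_irreducible_dvd_eval_mul_eval_neg {f : E[X]} {u v : E}
    (h : f.eval u * f.eval v < 0) :
    ∃ p, Irreducible p ∧ p ∣ f ∧ p.eval u * p.eval v < 0 := by
  induction f using WfDvdMonoid.induction_on_irreducible with
  | zero => simp at h
  | unit f hf =>
    obtain ⟨c, -, rfl⟩ := isUnit_iff.1 hf
    rw [eval_C, eval_C] at h
    exact absurd h (mul_self_nonneg c).not_gt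
  | mul f p hf hp ih =>
    rw [eval_mul, eval_mul, mul_mul_mul_comm] at h
    by_cases hpn : p.eval u * p.eval v < 0
    · exact ⟨p, hp, dvd_mul_right _ _, hpn⟩
    · obtain ⟨p', hp', hdvd, hlt⟩ := ih (by
        by_contra! hc
        exact (mul_nonneg (not_lt.1 hpn) hc).not_gt h)
      exact ⟨p', hp', hdvd.mul_left _, hlt⟩

theorem Irreducible.not_dvd_one_add_of_eval_mul_eval_neg {f : E[X]} (hf : Irreducible f) {u v : E}
    (h : f.eval u * f.eval v < 0) {s : E[X]} (hs : s ∈ weightedSumSq E) : ¬ f ∣ 1 + s := by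
  induction hd : f.natDegree using Nat.strong_induction_on generalizing f s with
  | _ d ih =>
  intro hdvd
  have hpos : 0 < f.natDegree := hf.natDegree_pos
  obtain ⟨s', hs', hdeg, hss'⟩ := exists_mem_weightedSumSq_natDegree_le hpos hs
  obtain ⟨g, hg⟩ : f ∣ 1 + s' := by
    have := dvd_sub hdvd hss'
    rwa [show 1 + s - (s - s') = 1 + s' by ring] at this
  have heval : ∀ x, 0 < f.eval x * g.eval x := by
    intro x
    rw [← eval_mul, ← hg, eval_add, eval_one]
    linarith [eval_nonneg_of_mem_weightedSumSq hs' x]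
  have hg0 : g ≠ 0 := fun h0 => by
    have := heval u
    simp [h0] at this
  have hgs : g.eval u * g.eval v < 0 := by
    have := mul_pos (heval u) (heval v)
    rw [mul_mul_mul_comm] at this
    exact neg_of_mul_pos_right this h.le
  obtain ⟨p, hp, hpg, hps⟩ := exists_irreducible_dvd_eval_mul_eval_neg hgs
  have hgdeg : f.natDegree + g.natDegree ≤ 2 * (f.natDegree - 1) := by
    rw [← natDegree_mul hf.ne_zero hg0, ← hg]
    exact (natDegree_add_le _ _).trans (by simpa using hdeg)
  have := natDegree_le_of_dvd hpg hg0
  exact ih p.natDegree (by omega) hp hps hs' rfl (hg ▸ hpg.mul_left f)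

end SignChange

section Ordering

/-- A maximal preordering is total with prime support. -/
theorem exists_isOrdering_of_le {A : Type*} [CommRing A] (T : RingPreordering A) :
    ∃ P : RingPreordering A, T ≤ P ∧ P.IsOrdering := by
  obtain ⟨P, hTP, hP⟩ := zorn_le_nonempty₀ (Set.univ : Set (RingPreordering A)) (by
    intro c _ hc y hy
    have hdir : ∀ a b, (∃ P ∈ c, a ∈ P) → (∃ P ∈ c, b ∈ P) → ∃ P ∈ c, a ∈ P ∧ b ∈ P := by
      rintro a b ⟨P, hP, ha⟩ ⟨Q, hQ, hb⟩
      rcases hc.total hP hQ with h | h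
      · exact ⟨Q, hQ, h ha, hb⟩
      · exact ⟨P, hP, ha, h hb⟩
    refine ⟨RingPreordering.mk' {a | ∃ P ∈ c, a ∈ P} ?_ ?_ ?_ ?_, trivial,
      fun P hP a ha => ⟨P, hP, ha⟩⟩
    · intro a b ha hb
      obtain ⟨P, hP, ha, hb⟩ := hdir a b ha hb
      exact ⟨P, hP, add_mem ha hb⟩
    · intro a b ha hb
      obtain ⟨P, hP, ha, hb⟩ := hdir a b ha hb
      exact ⟨P, hP, mul_mem ha hb⟩
    · exact fun a => ⟨y, hy, y.mul_self_mem a⟩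
    · rintro ⟨P, -, h⟩
      exact P.neg_one_notMem h) T trivial
  refine ⟨P, hTP, RingPreordering.isOrdering_iff.2 fun a b hab => ?_⟩
  have key : ∀ a ∉ P, ∃ s ∈ P, ∃ t ∈ P, -1 = s + a * t := by
    intro a ha
    by_contra! hne
    refine ha ?_
    have hle := hP.2 (y := RingPreordering.mk' {x | ∃ s ∈ P, ∃ t ∈ P, x = s + a * t} (by
        rintro _ _ ⟨s, hs, t, ht, rfl⟩ ⟨s', hs', t', ht', rfl⟩
        exact ⟨s + s', add_mem hs hs', t + t', add_mem ht ht', by ring⟩) (by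
        rintro _ _ ⟨s, hs, t, ht, rfl⟩ ⟨s', hs', t', ht', rfl⟩
        exact ⟨s * s' + a * a * (t * t'), add_mem (mul_mem hs hs')
          (mul_mem (P.mul_self_mem a) (mul_mem ht ht')), s * t' + t * s',
          add_mem (mul_mem hs ht') (mul_mem ht hs'), by ring⟩)
        (fun x => ⟨x * x, P.mul_self_mem x, 0, zero_mem P, by ring⟩)
        (by
          rintro ⟨s, hs, t, ht, h⟩
          exact hne s hs t ht h)) trivial (fun s hs => ⟨s, hs, 0, zero_mem P, by ring⟩)
    exact hle ⟨0, zero_mem P, 1, one_mem P, by ring⟩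
  by_contra! hcon
  obtain ⟨s, hs, t, ht, h⟩ := key a hcon.1
  obtain ⟨s', hs', t', ht', h'⟩ := key b hcon.2
  refine P.neg_one_notMem ?_
  rw [show (-1 : A) = s + s' + s * s' + -(a * b) * (t * t') by
    linear_combination (1 + s') * h - a * t * h']
  exact add_mem (add_mem (add_mem hs hs') (mul_mem hs hs')) (mul_mem hab (mul_mem ht ht'))

/-- A set that is the nonnegative cone of a partial order on the subring of its differences. -/
structure IsOrderCone {Ω : Type*} [Field Ω] (Q : Set Ω) : Prop where
  add_mem : ∀ a ∈ Q, ∀ b ∈ Q, a + b ∈ Q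
  mul_mem : ∀ a ∈ Q, ∀ b ∈ Q, a * b ∈ Q
  one_mem : 1 ∈ Q
  sub_sq_mem : ∀ a ∈ Q, ∀ b ∈ Q, (a - b) ^ 2 ∈ Q
  eq_zero : ∀ a ∈ Q, -a ∈ Q → a = 0

theorem exists_maximal_isOrderCone {Ω : Type*} [Field Ω] {Q : Set Ω} (hQ : IsOrderCone Q) :
    ∃ Q', Q ⊆ Q' ∧ IsOrderCone Q' ∧ ∀ Q'', IsOrderCone Q'' → Q' ⊆ Q'' → Q'' ⊆ Q' := by
  obtain ⟨Q', hQQ', hQ'⟩ := zorn_subset_nonempty {Q : Set Ω | IsOrderCone Q} (by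
    intro c hcS hc ⟨y, hy⟩
    have hdir : ∀ a ∈ ⋃₀ c, ∀ b ∈ ⋃₀ c, ∃ P ∈ c, a ∈ P ∧ b ∈ P := by
      rintro a ⟨P, hP, ha⟩ b ⟨Q, hQ, hb⟩
      rcases hc.total hP hQ with h | h
      · exact ⟨Q, hQ, h ha, hb⟩
      · exact ⟨P, hP, ha, h hb⟩
    refine ⟨⋃₀ c, ⟨fun a ha b hb => ?_, fun a ha b hb => ?_, ⟨y, hy, (hcS hy).one_mem⟩,
      fun a ha b hb => ?_, fun a ha hb => ?_⟩, fun P hP => Set.subset_sUnion_of_mem hP⟩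
    all_goals obtain ⟨P, hP, ha, hb⟩ := hdir _ ha _ hb
    · exact ⟨P, hP, (hcS hP).add_mem a ha b hb⟩
    · exact ⟨P, hP, (hcS hP).mul_mem a ha b hb⟩
    · exact ⟨P, hP, (hcS hP).sub_sq_mem a ha b hb⟩
    · exact (hcS hP).eq_zero a ha hb) Q hQ
  exact ⟨Q', hQQ', hQ'.1, fun Q'' h h' => hQ'.2 h h'⟩

end Ordering

universe u

section OrderedSubfield

variable {Ω : Type*} [Field Ω] {Q : Set Ω}

theorem IsOrderCone.zero_mem (hQ : IsOrderCone Q) : 0 ∈ Q := by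
  simpa using hQ.sub_sq_mem 1 hQ.one_mem 1 hQ.one_mem

/-- The subring of differences of elements of an order cone. -/
def IsOrderCone.subring (hQ : IsOrderCone Q) : Subring Ω where
  carrier := {x | ∃ a ∈ Q, ∃ b ∈ Q, x = a - b}
  zero_mem' := ⟨0, hQ.zero_mem, 0, hQ.zero_mem, by ring⟩
  one_mem' := ⟨1, hQ.one_mem, 0, hQ.zero_mem, by ring⟩
  add_mem' := by
    rintro _ _ ⟨a, ha, b, hb, rfl⟩ ⟨c, hc, d, hd, rfl⟩
    exact ⟨a + c, hQ.add_mem a ha c hc, b + d, hQ.add_mem b hb d hd, by ring⟩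
  neg_mem' := by
    rintro _ ⟨a, ha, b, hb, rfl⟩
    exact ⟨b, hb, a, ha, by ring⟩
  mul_mem' := by
    rintro _ _ ⟨a, ha, b, hb, rfl⟩ ⟨c, hc, d, hd, rfl⟩
    exact ⟨a * c + b * d, hQ.add_mem _ (hQ.mul_mem a ha c hc) _ (hQ.mul_mem b hb d hd),
      a * d + b * c, hQ.add_mem _ (hQ.mul_mem a ha d hd) _ (hQ.mul_mem b hb c hc), by ring⟩

theorem IsOrderCone.subset_subring (hQ : IsOrderCone Q) : Q ⊆ hQ.subring :=
  fun a ha => ⟨a, ha, 0, hQ.zero_mem, by ring⟩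

theorem IsOrderCone.sq_mem (hQ : IsOrderCone Q) {x : Ω} (hx : x ∈ hQ.subring) : x ^ 2 ∈ Q := by
  obtain ⟨a, ha, b, hb, rfl⟩ := hx
  exact hQ.sub_sq_mem a ha b hb

/-- An order cone is maximal if it is not contained in a larger one. -/
structure IsMaxOrderCone (Q : Set Ω) : Prop extends IsOrderCone Q where
  subset_of_subset : ∀ Q', IsOrderCone Q' → Q ⊆ Q' → Q' ⊆ Q

namespace IsMaxOrderCone

theorem inv_mem (hQ : IsMaxOrderCone Q) {a : Ω} (ha : a ∈ Q) : a⁻¹ ∈ Q := by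
  rcases eq_or_ne a 0 with rfl | ha0
  · simpa using ha
  have hpow : ∀ k : ℕ, a ^ k ∈ Q := by
    intro k
    induction k with
    | zero => simpa using hQ.one_mem
    | succ k ih => exact pow_succ a k ▸ hQ.mul_mem _ ih _ ha
  have hmul : ∀ x (k l : ℕ), x * a ^ k ∈ Q → x * a ^ (k + l) ∈ Q := by
    intro x k l h
    rw [pow_add, ← mul_assoc]
    exact hQ.mul_mem _ h _ (hpow l)
  refine hQ.subset_of_subset {x | ∃ k : ℕ, x * a ^ k ∈ Q} ⟨?_, ?_, ⟨0, ?_⟩, ?_, ?_⟩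
    (fun x hx => ⟨0, by simpa using hx⟩) ⟨1, ?_⟩
  · rintro x ⟨k, hk⟩ y ⟨l, hl⟩
    refine ⟨k + l, ?_⟩
    rw [add_mul]
    exact hQ.add_mem _ (hmul x k l hk) _ (add_comm k l ▸ hmul y l k hl)
  · rintro x ⟨k, hk⟩ y ⟨l, hl⟩
    refine ⟨k + l, ?_⟩
    rw [pow_add, mul_mul_mul_comm]
    exact hQ.mul_mem _ hk _ hl
  · simpa using hQ.one_mem
  · rintro x ⟨k, hk⟩ y ⟨l, hl⟩
    refine ⟨2 * (k + l), ?_⟩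
    rw [mul_comm 2, pow_mul, ← mul_pow, sub_mul]
    exact hQ.sub_sq_mem _ (hmul x k l hk) _ (add_comm k l ▸ hmul y l k hl)
  · rintro x ⟨k, hk⟩ ⟨l, hl⟩
    have := hQ.eq_zero _ (hmul x k l hk) (by
      rw [← neg_mul]
      exact add_comm k l ▸ hmul (-x) l k hl)
    exact (mul_eq_zero.1 this).resolve_right (pow_ne_zero _ ha0)
  · rw [pow_one, inv_mul_cancel₀ ha0]
    exact hQ.one_mem

/-- The subfield of differences of elements of a maximal order cone. -/
def subfield (hQ : IsMaxOrderCone Q) : Subfield Ω where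
  __ := hQ.subring
  inv_mem' x hx := by
    rcases eq_or_ne x 0 with rfl | h0
    · simp
    have : x⁻¹ = x * (x ^ 2)⁻¹ := by field_simp
    rw [this]
    exact hQ.subring.mul_mem hx (hQ.subset_subring (hQ.inv_mem (hQ.sq_mem hx)))

theorem mem_subfield (hQ : IsMaxOrderCone Q) {x : Ω} : x ∈ hQ.subfield ↔ x ∈ hQ.subring := Iff.rfl

theorem mem_or_neg_mem (hQ : IsMaxOrderCone Q) {x : Ω} (hx : x ∈ hQ.subring) : x ∈ Q ∨ -x ∈ Q := by
  refine or_iff_not_imp_right.2 fun hneg => ?_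
  have hsub : ∀ {y}, y ∈ Q → y ∈ hQ.subring := fun hy => hQ.subset_subring hy
  refine hQ.subset_of_subset {y | ∃ s ∈ Q, ∃ t ∈ Q, y = s + x * t} ⟨?_, ?_, ?_, ?_, ?_⟩
    (fun s hs => ⟨s, hs, 0, hQ.zero_mem, by ring⟩) ⟨0, hQ.zero_mem, 1, hQ.one_mem, by ring⟩
  · rintro _ ⟨s, hs, t, ht, rfl⟩ _ ⟨s', hs', t', ht', rfl⟩
    exact ⟨s + s', hQ.add_mem _ hs _ hs', t + t', hQ.add_mem _ ht _ ht', by ring⟩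
  · rintro _ ⟨s, hs, t, ht, rfl⟩ _ ⟨s', hs', t', ht', rfl⟩
    exact ⟨s * s' + x ^ 2 * (t * t'), hQ.add_mem _ (hQ.mul_mem _ hs _ hs') _
      (hQ.mul_mem _ (hQ.sq_mem hx) _ (hQ.mul_mem _ ht _ ht')), s * t' + t * s',
      hQ.add_mem _ (hQ.mul_mem _ hs _ ht') _ (hQ.mul_mem _ ht _ hs'), by ring⟩
  · exact ⟨1, hQ.one_mem, 0, hQ.zero_mem, by ring⟩
  · rintro _ ⟨s, hs, t, ht, rfl⟩ _ ⟨s', hs', t', ht', rfl⟩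
    refine ⟨_, hQ.sq_mem ?_, 0, hQ.zero_mem, (by ring : _ = (s + x * t - (s' + x * t')) ^ 2 + _)⟩
    exact sub_mem (add_mem (hsub hs) (mul_mem hx (hsub ht)))
      (add_mem (hsub hs') (mul_mem hx (hsub ht')))
  · rintro _ ⟨s, hs, t, ht, rfl⟩ ⟨s', hs', t', ht', h⟩
    have h1 : s + s' = -x * (t + t') := by linear_combination -h
    by_cases h0 : t + t' = 0
    · have ht0 : t = 0 := hQ.eq_zero t ht (by rwa [neg_eq_of_add_eq_zero_right h0])
      rw [h0, mul_zero] at h1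
      rw [ht0, hQ.eq_zero s hs (by rwa [neg_eq_of_add_eq_zero_right h1])]
      ring
    · refine absurd ?_ hneg
      rw [eq_comm, ← eq_mul_inv_iff_mul_eq₀ h0] at h1
      rw [h1]
      exact hQ.mul_mem _ (hQ.add_mem _ hs _ hs') _ (hQ.inv_mem (hQ.add_mem _ ht _ ht'))

/-- The linear order on the subfield attached to a maximal order cone. -/
@[reducible]
noncomputable def linearOrder (hQ : IsMaxOrderCone Q) : LinearOrder hQ.subfield where
  le x y := (y - x : Ω) ∈ Q
  le_refl x := by
    rw [sub_self]
    exact hQ.zero_mem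
  le_trans x y z hxy hyz := by
    have := hQ.add_mem _ hxy _ hyz
    rwa [sub_add_sub_cancel'] at this
  le_antisymm x y hxy hyx := by
    refine Subtype.ext (sub_eq_zero.1 (hQ.eq_zero _ hyx ?_))
    rwa [neg_sub]
  le_total x y := by
    have := hQ.mem_or_neg_mem (hQ.mem_subfield.1 (y - x).2)
    rwa [Subfield.coe_sub, neg_sub] at this
  toDecidableLE := Classical.decRel _

theorem nonneg_iff (hQ : IsMaxOrderCone Q) (x : hQ.subfield) :
    let _ := hQ.linearOrder
    0 ≤ x ↔ (x : Ω) ∈ Q := by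
  change (x - 0 : Ω) ∈ Q ↔ _
  rw [sub_zero]

theorem isStrictOrderedRing (hQ : IsMaxOrderCone Q) :
    let _ := hQ.linearOrder
    IsStrictOrderedRing hQ.subfield := by
  intro _
  have h1 : IsOrderedAddMonoid hQ.subfield :=
    ⟨fun a b h c => by
      change ((b + c : hQ.subfield) - (a + c : hQ.subfield) : Ω) ∈ Q
      rw [Subfield.coe_add, Subfield.coe_add, add_sub_add_right_eq_sub]
      exact h, fun a b h c => by
      change ((c + b : hQ.subfield) - (c + a : hQ.subfield) : Ω) ∈ Q
      rw [Subfield.coe_add, Subfield.coe_add, add_sub_add_left_eq_sub]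
      exact h⟩
  have h2 : ZeroLEOneClass hQ.subfield := ⟨(hQ.nonneg_iff 1).2 hQ.one_mem⟩
  refine IsStrictOrderedRing.of_mul_pos fun a b ha hb => lt_of_le_of_ne ?_ ?_
  · exact (hQ.nonneg_iff _).2 (hQ.mul_mem _ ((hQ.nonneg_iff a).1 ha.le) _ ((hQ.nonneg_iff b).1 hb.le))
  · exact (mul_ne_zero ha.ne' hb.ne').symm

theorem polyIVT [IsAlgClosed Ω] (hQ : IsMaxOrderCone Q) :
    let _ := hQ.linearOrder
    PolyIVT hQ.subfield := by
  intro _ f a b hab ha hb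
  have := hQ.isStrictOrderedRing
  obtain ⟨p, hp, hpf, hsign⟩ := exists_irreducible_dvd_eval_mul_eval_neg
    (mul_neg_of_neg_of_pos ha hb)
  obtain ⟨θ, hθ⟩ := IsAlgClosed.exists_aeval_eq_zero Ω p (degree_pos_of_irreducible hp).ne'
  have hdvd : ∀ s : hQ.subfield[X], aeval θ s = 0 → p ∣ s := by
    intro s hs
    have h1 := minpoly.dvd _ _ hs
    have h2 := minpoly.dvd _ _ hθ
    have h3 := minpoly.irreducible (isAlgebraic_iff_isIntegral.1 ⟨p, hp.ne_zero, hθ⟩)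
    exact ((hp.dvd_comm h3).2 h2).trans h1
  have hcone : IsOrderCone (aeval θ '' (weightedSumSq hQ.subfield : Set hQ.subfield[X])) := by
    refine ⟨?_, ?_, ⟨1, by simpa using sq_mem_weightedSumSq (1 : hQ.subfield[X]), by simp⟩, ?_, ?_⟩
    · rintro _ ⟨s, hs, rfl⟩ _ ⟨t, ht, rfl⟩
      exact ⟨s + t, add_mem hs ht, by simp⟩
    · rintro _ ⟨s, hs, rfl⟩ _ ⟨t, ht, rfl⟩
      exact ⟨s * t, mul_mem_weightedSumSq hs ht, by simp⟩
    · rintro _ ⟨s, hs, rfl⟩ _ ⟨t, ht, rfl⟩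
      exact ⟨(s - t) ^ 2, sq_mem_weightedSumSq _, by simp⟩
    · rintro _ ⟨s, hs, rfl⟩ ⟨t, ht, hst⟩
      by_contra hs0
      have hcop : IsCoprime p s := (EuclideanDomain.dvd_or_coprime p s hp).resolve_left fun h =>
        hs0 (by
          obtain ⟨k, rfl⟩ := h
          rw [map_mul, hθ, zero_mul])
      obtain ⟨k, h, hkh⟩ := hcop
      have h1 := congrArg (aeval θ) hkh
      rw [map_add, map_mul, map_mul, hθ, mul_zero, zero_add, map_one] at h1
      refine hp.not_dvd_one_add_of_eval_mul_eval_neg hsign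
        (mul_mem_weightedSumSq (mul_mem_weightedSumSq hs ht) (sq_mem_weightedSumSq h)) (hdvd _ ?_)
      rw [map_add, map_mul, map_mul, map_pow, hst, map_one]
      linear_combination (-1 - aeval θ h * aeval θ s) * h1
  have hsub : Q ⊆ aeval θ '' (weightedSumSq hQ.subfield : Set hQ.subfield[X]) := by
    intro q hq
    refine ⟨C ⟨q, hQ.subset_subring hq⟩ * 1 ^ 2, C_mul_sq_mem_weightedSumSq ?_ _, ?_⟩
    · exact (hQ.nonneg_iff _).2 hq
    · rw [one_pow, mul_one, aeval_C]
      rfl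
  have hmax := hQ.subset_of_subset _ hcone hsub
  have hθE : θ ∈ hQ.subfield := by
    have h1 : (θ + 1) ^ 2 ∈ hQ.subfield := hQ.subset_subring
      (hmax ⟨(X + 1) ^ 2, sq_mem_weightedSumSq _, by simp⟩)
    have h2 : (θ - 1) ^ 2 ∈ hQ.subfield := hQ.subset_subring
      (hmax ⟨(X - 1) ^ 2, sq_mem_weightedSumSq _, by simp⟩)
    have h4 : (4 : hQ.subfield) ≠ 0 := by norm_num
    have h4' : (4 : Ω) ≠ 0 := fun h => h4 (Subtype.ext h)
    have : θ = ((θ + 1) ^ 2 - (θ - 1) ^ 2) * ((4 : hQ.subfield)⁻¹ : hQ.subfield) := by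
      rw [show (((4 : hQ.subfield)⁻¹ : hQ.subfield) : Ω) = 4⁻¹ from rfl]
      field_simp
      ring
    rw [this]
    exact mul_mem (sub_mem h1 h2) (SetLike.coe_mem _)
  have hroot : p.IsRoot ⟨θ, hθE⟩ := by
    have : aeval θ p = ((p.eval ⟨θ, hθE⟩ : hQ.subfield) : Ω) :=
      eval₂_at_apply (p := p) (algebraMap hQ.subfield Ω) ⟨θ, hθE⟩
    rw [hθ] at this
    exact Subtype.ext (by exact_mod_cast this.symm)
  obtain ⟨g, hg⟩ := dvd_iff_isRoot.2 hroot
  have hgu : IsUnit g := (hp.isUnit_or_isUnit hg).resolve_left (not_isUnit_X_sub_C _)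
  obtain ⟨c, -, rfl⟩ := isUnit_iff.1 hgu
  refine ⟨⟨θ, hθE⟩, ?_, ?_⟩
  · rw [hg] at hsign
    simp only [eval_mul, eval_sub, eval_X, eval_C] at hsign
    set t : hQ.subfield := ⟨θ, hθE⟩
    have h1 : (a - t) * (b - t) < 0 := by
      by_contra! h
      nlinarith [mul_nonneg h (sq_nonneg c)]
    constructor
    · by_contra! h
      nlinarith
    · by_contra! h
      nlinarith
  · obtain ⟨k, rfl⟩ := hpf
    rw [eval_mul, hroot.eq_zero, zero_mul]

end IsMaxOrderCone

end OrderedSubfield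

/-- Every preordering of a commutative ring is nonnegative under a homomorphism to an ordered
field with the intermediate value property for polynomials. -/
theorem RingPreordering.exists_ringHom_nonneg {A : Type u} [CommRing A] (T : RingPreordering A) :
    ∃ (R : Type u) (_ : Field R) (_ : LinearOrder R) (_ : IsStrictOrderedRing R) (φ : A →+* R),
      PolyIVT R ∧ ∀ a ∈ T, 0 ≤ φ a := by
  obtain ⟨P, hTP, hP⟩ := exists_isOrdering_of_le T
  let Ω := AlgebraicClosure (FractionRing (A ⧸ P.support))
  let ι : A →+* Ω := (algebraMap (FractionRing (A ⧸ P.support)) Ω).comp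
    ((algebraMap (A ⧸ P.support) _).comp (Ideal.Quotient.mk P.support))
  have hι : ∀ a, ι a = 0 ↔ a ∈ P ∧ -a ∈ P := by
    intro a
    rw [← RingPreordering.mem_support, ← Ideal.Quotient.eq_zero_iff_mem]
    simp only [ι, RingHom.comp_apply, map_eq_zero]
    exact map_eq_zero_iff _ (IsFractionRing.injective (A ⧸ P.support) _)
  obtain ⟨Q, hPQ, hQ, hmax⟩ := exists_maximal_isOrderCone (Q := ι '' P) (by
    refine ⟨?_, ?_, ⟨1, one_mem P, map_one ι⟩, ?_, ?_⟩
    · rintro _ ⟨a, ha, rfl⟩ _ ⟨b, hb, rfl⟩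
      exact ⟨a + b, add_mem ha hb, map_add _ _ _⟩
    · rintro _ ⟨a, ha, rfl⟩ _ ⟨b, hb, rfl⟩
      exact ⟨a * b, mul_mem ha hb, map_mul _ _ _⟩
    · rintro _ ⟨a, -, rfl⟩ _ ⟨b, -, rfl⟩
      exact ⟨(a - b) ^ 2, P.pow_two_mem _, by simp⟩
    · rintro _ ⟨a, ha, rfl⟩ ⟨b, hb, hab⟩
      have h0 : ι (a + b) = 0 := by rw [map_add, hab, add_neg_cancel]
      refine (hι a).2 ⟨ha, ?_⟩
      have := add_mem hb ((hι _).1 h0).2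
      rwa [neg_add_rev, ← add_assoc, add_neg_cancel, zero_add] at this)
  have hQ' : IsMaxOrderCone Q := ⟨hQ, hmax⟩
  refine ⟨hQ'.subfield, inferInstance, hQ'.linearOrder, hQ'.isStrictOrderedRing,
    ι.codRestrict hQ'.subfield fun a => ?_, hQ'.polyIVT, fun a ha => ?_⟩
  · change ι a ∈ hQ.subring
    rcases mem_or_neg_mem P a with ha | ha
    · exact hQ.subset_subring (hPQ ⟨a, ha, rfl⟩)
    · have := neg_mem (hQ.subset_subring (hPQ ⟨-a, ha, rfl⟩))
      rwa [map_neg, neg_neg] at this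
  · exact (hQ'.nonneg_iff _).2 (hPQ ⟨a, hTP ha, rfl⟩)

section Schmudgen

variable {n m : ℕ}

/-- The preordering of `ℝ[x₁,…,xₙ]` generated by the polynomials `g j`. -/
noncomputable def generatedPreordering (g : Fin m → MvPolynomial (Fin n) ℝ) :
    Subsemiring (MvPolynomial (Fin n) ℝ) where
  __ := AddSubmonoid.closure {p | ∃ (β : Fin m → Bool) (h : MvPolynomial (Fin n) ℝ),
    p = h ^ 2 * ∏ j, if β j then g j else 1}
  one_mem' := AddSubmonoid.subset_closure ⟨fun _ => false, 1, by simp⟩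
  mul_mem' := by
    intro a b ha hb
    change a * b ∈ AddSubmonoid.closure _
    refine AddSubmonoid.closure_induction (fun s hs => ?_) (by simp) (fun x y _ _ hx hy => ?_) ha
    · obtain ⟨β, h, rfl⟩ := hs
      refine AddSubmonoid.closure_induction (fun t ht => ?_) (by simp) (fun x y _ _ hx hy => ?_) hb
      · obtain ⟨γ, h', rfl⟩ := ht
        refine AddSubmonoid.subset_closure ⟨fun j => xor (β j) (γ j),
          h * h' * ∏ j, (if β j && γ j then g j else 1), ?_⟩
        have : (∏ j, if β j then g j else 1) * (∏ j, if γ j then g j else 1) =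
            (∏ j, if β j && γ j then g j else 1) ^ 2 * ∏ j, if xor (β j) (γ j) then g j else 1 := by
          rw [← Finset.prod_pow, ← Finset.prod_mul_distrib, ← Finset.prod_mul_distrib]
          refine Finset.prod_congr rfl fun j _ => ?_
          cases β j <;> cases γ j <;> simp [sq]
        rw [mul_mul_mul_comm, this]
        ring
      · rw [mul_add]
        exact add_mem hx hy
    · rw [add_mul]
      exact add_mem hx hy

theorem mul_self_mem_generatedPreordering (g : Fin m → MvPolynomial (Fin n) ℝ)
    (a : MvPolynomial (Fin n) ℝ) : a * a ∈ generatedPreordering g :=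
  AddSubmonoid.subset_closure ⟨fun _ => false, a, by simp [sq]⟩

theorem mem_generatedPreordering (g : Fin m → MvPolynomial (Fin n) ℝ) (j : Fin m) :
    g j ∈ generatedPreordering g := by
  refine AddSubmonoid.subset_closure ⟨fun i => decide (i = j), 1, ?_⟩
  simp

variable {T : Subsemiring (MvPolynomial (Fin n) ℝ)}

theorem C_mem_of_nonneg (hsq : ∀ a, a * a ∈ T) {r : ℝ} (hr : 0 ≤ r) : MvPolynomial.C r ∈ T := by
  have := hsq (MvPolynomial.C (√r))
  rwa [← MvPolynomial.C_mul, Real.mul_self_sqrt hr] at this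

theorem exists_mul_eq_one_add (hsq : ∀ a, a * a ∈ T) {g : Fin m → MvPolynomial (Fin n) ℝ}
    (hg : ∀ j, g j ∈ T) {p : MvPolynomial (Fin n) ℝ}
    (hp : ∀ x, (∀ j, 0 ≤ MvPolynomial.eval x (g j)) → 0 < MvPolynomial.eval x p) :
    ∃ σ ∈ T, ∃ τ ∈ T, p * σ = 1 + τ := by
  classical
  by_contra! hne
  obtain ⟨R, _, _, _, φ, hR, hφ⟩ := (RingPreordering.mk' {a | ∃ s ∈ T, ∃ t ∈ T, a = s - p * t} (by
      rintro _ _ ⟨s, hs, t, ht, rfl⟩ ⟨s', hs', t', ht', rfl⟩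
      exact ⟨s + s', add_mem hs hs', t + t', add_mem ht ht', by ring⟩) (by
      rintro _ _ ⟨s, hs, t, ht, rfl⟩ ⟨s', hs', t', ht', rfl⟩
      exact ⟨s * s' + p * p * (t * t'), add_mem (mul_mem hs hs')
        (mul_mem (hsq p) (mul_mem ht ht')), s * t' + t * s',
        add_mem (mul_mem hs ht') (mul_mem ht hs'), by ring⟩)
      (fun x => ⟨x * x, hsq x, 0, zero_mem T, by ring⟩)
      (by
        rintro ⟨s, hs, t, ht, h⟩
        exact hne t ht s hs (by linear_combination h))).exists_ringHom_nonneg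
  obtain ⟨x, hx⟩ := MvPolynomial.exists_sign_eval_eq hR φ (insert p (Finset.univ.image g))
  have hpx := hp x fun j => by
    rw [← sign_nonneg_iff, hx (g j) (by simp), sign_nonneg_iff]
    exact hφ _ ⟨g j, hg j, 0, zero_mem T, by ring⟩
  have h1 : φ p ≤ 0 := by
    have := hφ (-p) ⟨0, zero_mem T, 1, one_mem T, by ring⟩
    rwa [map_neg, neg_nonneg] at this
  rw [← sign_eq_one_iff, hx p (Finset.mem_insert_self _ _), sign_eq_one_iff] at hpx
  exact h1.not_gt hpx

theorem exists_C_sub_mem (hsq : ∀ a, a * a ∈ T) {N : ℝ}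
    (hN : MvPolynomial.C N - ∑ i, MvPolynomial.X i ^ 2 ∈ T) (a : MvPolynomial (Fin n) ℝ) :
    ∃ k : ℝ, 0 ≤ k ∧ MvPolynomial.C k - a ∈ T := by
  suffices H : ∃ k : ℝ, 0 ≤ k ∧ MvPolynomial.C k - a ∈ T ∧ MvPolynomial.C k + a ∈ T from
    ⟨H.choose, H.choose_spec.1, H.choose_spec.2.1⟩
  have hC : ∀ {r : ℝ}, 0 ≤ r → MvPolynomial.C r ∈ T := fun hr => C_mem_of_nonneg hsq hr
  have hadd : ∀ a b : MvPolynomial (Fin n) ℝ,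
      (∃ k : ℝ, 0 ≤ k ∧ MvPolynomial.C k - a ∈ T ∧ MvPolynomial.C k + a ∈ T) →
      (∃ k : ℝ, 0 ≤ k ∧ MvPolynomial.C k - b ∈ T ∧ MvPolynomial.C k + b ∈ T) →
      ∃ k : ℝ, 0 ≤ k ∧ MvPolynomial.C k - (a + b) ∈ T ∧ MvPolynomial.C k + (a + b) ∈ T := by
    rintro a b ⟨k, hk, h1, h2⟩ ⟨l, hl, h3, h4⟩
    refine ⟨k + l, add_nonneg hk hl, ?_, ?_⟩
    · rw [MvPolynomial.C_add, add_sub_add_comm]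
      exact add_mem h1 h3
    · rw [MvPolynomial.C_add, add_add_add_comm]
      exact add_mem h2 h4
  have hneg : ∀ b : MvPolynomial (Fin n) ℝ,
      (∃ k : ℝ, 0 ≤ k ∧ MvPolynomial.C k - b ∈ T ∧ MvPolynomial.C k + b ∈ T) →
      ∃ k : ℝ, 0 ≤ k ∧ MvPolynomial.C k - -b ∈ T ∧ MvPolynomial.C k + -b ∈ T := by
    rintro b ⟨k, hk, h1, h2⟩
    exact ⟨k, hk, by rwa [sub_neg_eq_add], by rwa [← sub_eq_add_neg]⟩
  have hhalf : ∀ {r : ℝ} {a b : MvPolynomial (Fin n) ℝ}, 0 ≤ r → MvPolynomial.C r * a = b → a ∈ T →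
      b ∈ T := fun hr h ha => h ▸ mul_mem (hC hr) ha
  have hprod : ∀ a b : MvPolynomial (Fin n) ℝ,
      (∃ k : ℝ, 0 ≤ k ∧ MvPolynomial.C k - (a + b) ∈ T ∧ MvPolynomial.C k + (a + b) ∈ T) →
      ∃ k : ℝ, 0 ≤ k ∧ MvPolynomial.C k - a * b ∈ T := by
    rintro a b ⟨k, -, h1, h2⟩
    refine ⟨k ^ 2 / 4, by positivity, ?_⟩
    have h3 := add_mem (mul_mem h1 h2) (hsq (a - b))
    refine hhalf (r := 1 / 4) (by norm_num) ?_ h3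
    have h4 : (MvPolynomial.C (1 / 4 : ℝ) : MvPolynomial (Fin n) ℝ) * 4 = 1 := by
      rw [← map_ofNat (MvPolynomial.C : ℝ →+* MvPolynomial (Fin n) ℝ) 4, ← MvPolynomial.C_mul]
      norm_num
    rw [show k ^ 2 / 4 = 1 / 4 * (k * k) by ring, MvPolynomial.C_mul, MvPolynomial.C_mul]
    linear_combination (-(a * b)) * h4
  induction a using MvPolynomial.induction_on with
  | C r =>
    refine ⟨|r|, abs_nonneg r, ?_, ?_⟩
    · rw [← MvPolynomial.C_sub]
      exact hC (sub_nonneg.2 (le_abs_self r))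
    · rw [← MvPolynomial.C_add]
      exact hC (by linarith [neg_abs_le r])
  | add a b ha hb => exact hadd a b ha hb
  | mul_X a i ha =>
    have hX : ∃ k : ℝ, 0 ≤ k ∧ MvPolynomial.C k - MvPolynomial.X i ∈ T ∧
        MvPolynomial.C k + MvPolynomial.X i ∈ T := by
      have h1 : MvPolynomial.C N - MvPolynomial.X i ^ 2 ∈ T := by
        have : MvPolynomial.C N - MvPolynomial.X i ^ 2 = (MvPolynomial.C N - ∑ i, MvPolynomial.X i ^ 2)
            + ∑ j ∈ Finset.univ.erase i, MvPolynomial.X (R := ℝ) j ^ 2 := by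
          rw [← Finset.add_sum_erase _ _ (Finset.mem_univ i)]
          ring
        rw [this]
        exact add_mem hN (sum_mem fun j _ => sq (MvPolynomial.X (R := ℝ) j) ▸ hsq _)
      have h2 : (MvPolynomial.C (1 / 2 : ℝ) : MvPolynomial (Fin n) ℝ) * 2 = 1 := by
        rw [← map_ofNat (MvPolynomial.C : ℝ →+* MvPolynomial (Fin n) ℝ) 2, ← MvPolynomial.C_mul]
        norm_num
      refine ⟨(|N| + 1) / 2, by positivity, ?_, ?_⟩
      · refine hhalf (r := 1 / 2) (by norm_num) ?_
          (add_mem (add_mem h1 (hsq (1 - MvPolynomial.X i))) (hC (sub_nonneg.2 (le_abs_self N))))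
        rw [show (|N| + 1) / 2 = 1 / 2 * (|N| + 1) by ring, MvPolynomial.C_mul, MvPolynomial.C_sub,
          MvPolynomial.C_add, MvPolynomial.C_1]
        linear_combination (-MvPolynomial.X i) * h2
      · refine hhalf (r := 1 / 2) (by norm_num) ?_
          (add_mem (add_mem h1 (hsq (1 + MvPolynomial.X i))) (hC (sub_nonneg.2 (le_abs_self N))))
        rw [show (|N| + 1) / 2 = 1 / 2 * (|N| + 1) by ring, MvPolynomial.C_mul, MvPolynomial.C_sub,
          MvPolynomial.C_add, MvPolynomial.C_1]
        linear_combination (MvPolynomial.X i) * h2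
    obtain ⟨k, hk, h1⟩ := hprod _ _ (hadd _ _ ha hX)
    obtain ⟨l, hl, h2⟩ := hprod _ _ (hadd _ _ (hneg _ ha) hX)
    refine ⟨k + l, add_nonneg hk hl, ?_, ?_⟩
    · rw [MvPolynomial.C_add, add_sub_right_comm]
      exact add_mem h1 (hC hl)
    · rw [MvPolynomial.C_add, add_assoc]
      refine add_mem (hC hk) ?_
      rwa [neg_mul, sub_neg_eq_add] at h2

theorem exists_C_sub_sum_sq_mem (hsq : ∀ a, a * a ∈ T) {N : ℝ} (hN : 0 ≤ N)
    {σ τ : MvPolynomial (Fin n) ℝ} (hσ : σ ∈ T) (hτ : τ ∈ T)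
    (h : (MvPolynomial.C N - ∑ i, MvPolynomial.X i ^ 2) * σ = 1 + τ) :
    ∃ N' : ℝ, MvPolynomial.C N' - ∑ i, MvPolynomial.X i ^ 2 ∈ T := by
  set s : MvPolynomial (Fin n) ℝ := ∑ i, MvPolynomial.X i ^ 2 with hs
  set p := MvPolynomial.C N - s with hp
  have hsT : s ∈ T := sum_mem fun j _ => sq (MvPolynomial.X (R := ℝ) j) ▸ hsq _
  let T₁ : Subsemiring (MvPolynomial (Fin n) ℝ) :=
    { carrier := {a | ∃ b ∈ T, ∃ c ∈ T, a = b + c * p}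
      zero_mem' := ⟨0, zero_mem T, 0, zero_mem T, by ring⟩
      one_mem' := ⟨1, one_mem T, 0, zero_mem T, by ring⟩
      add_mem' := by
        rintro _ _ ⟨b, hb, c, hc, rfl⟩ ⟨b', hb', c', hc', rfl⟩
        exact ⟨b + b', add_mem hb hb', c + c', add_mem hc hc', by ring⟩
      mul_mem' := by
        rintro _ _ ⟨b, hb, c, hc, rfl⟩ ⟨b', hb', c', hc', rfl⟩
        exact ⟨b * b' + p * p * (c * c'), add_mem (mul_mem hb hb')
          (mul_mem (hsq p) (mul_mem hc hc')), b * c' + c * b',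
          add_mem (mul_mem hb hc') (mul_mem hc hb'), by ring⟩ }
  obtain ⟨k, hk, b, hb, c, hc, hkτ⟩ := exists_C_sub_mem (T := T₁)
    (fun a => ⟨a * a, hsq a, 0, zero_mem T, by ring⟩) ⟨0, zero_mem T, 1, one_mem T, by ring⟩ τ
  have hpT : (1 + τ) * p ∈ T := by
    rw [← h, show p * σ * p = σ * (p * p) by ring]
    exact mul_mem hσ (hsq p)
  have h1 : MvPolynomial.C (k + k ^ 2 / 4) - τ ∈ T := by
    have h4 : (MvPolynomial.C (k ^ 2 / 4) : MvPolynomial (Fin n) ℝ) =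
        MvPolynomial.C (k / 2) * MvPolynomial.C (k / 2) := by
      rw [← MvPolynomial.C_mul]
      ring_nf
    have h5 : (MvPolynomial.C k : MvPolynomial (Fin n) ℝ) =
        MvPolynomial.C (k / 2) + MvPolynomial.C (k / 2) := by
      rw [← MvPolynomial.C_add]
      ring_nf
    have : MvPolynomial.C (k + k ^ 2 / 4) - τ = (1 + τ) * b + c * ((1 + τ) * p) +
        (τ - MvPolynomial.C (k / 2)) * (τ - MvPolynomial.C (k / 2)) := by
      rw [MvPolynomial.C_add, h4]
      linear_combination (1 + τ) * hkτ - τ * h5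
    rw [this]
    exact add_mem (add_mem (mul_mem (add_mem (one_mem T) hτ) hb) (mul_mem hc hpT)) (hsq _)
  refine ⟨N * (k + k ^ 2 / 4) + N, ?_⟩
  have : MvPolynomial.C (N * (k + k ^ 2 / 4) + N) - s =
      MvPolynomial.C N * (MvPolynomial.C (k + k ^ 2 / 4) - τ) + (1 + τ) * p + s * τ := by
    rw [MvPolynomial.C_add, MvPolynomial.C_mul, hp]
    ring
  rw [this]
  exact add_mem (add_mem (mul_mem (C_mem_of_nonneg hsq hN) h1) hpT) (mul_mem hsT hτ)

/-- Schmüdgen's Positivstellensatz. -/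
theorem mem_generatedPreordering_of_pos {g : Fin m → MvPolynomial (Fin n) ℝ}
    (hK : IsCompact {x : Fin n → ℝ | ∀ j, 0 ≤ MvPolynomial.eval x (g j)})
    {p : MvPolynomial (Fin n) ℝ}
    (hp : ∀ x, (∀ j, 0 ≤ MvPolynomial.eval x (g j)) → 0 < MvPolynomial.eval x p) :
    p ∈ generatedPreordering g := by
  set T := generatedPreordering g
  have hsq : ∀ a, a * a ∈ T := mul_self_mem_generatedPreordering g
  have hg : ∀ j, g j ∈ T := mem_generatedPreordering g
  obtain ⟨N, hN⟩ := hK.bddAbove_image (f := fun x : Fin n → ℝ => ∑ i, x i ^ 2)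
    (by fun_prop)
  have hN' : ∀ x : Fin n → ℝ, (∀ j, 0 ≤ MvPolynomial.eval x (g j)) → ∑ i, x i ^ 2 ≤ N :=
    fun x hx => hN ⟨x, hx, rfl⟩
  obtain ⟨σ₀, hσ₀, τ₀, hτ₀, h₀⟩ := exists_mul_eq_one_add hsq hg
    (p := MvPolynomial.C (|N| + 1) - ∑ i, MvPolynomial.X i ^ 2) (fun x hx => by
      simp only [map_sub, MvPolynomial.eval_C, map_sum, map_pow, MvPolynomial.eval_X]
      linarith [hN' x hx, le_abs_self N])
  obtain ⟨N₁, hN₁⟩ := exists_C_sub_sum_sq_mem hsq (by positivity) hσ₀ hτ₀ h₀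
  obtain ⟨σ, hσ, τ, hτ, h⟩ := exists_mul_eq_one_add hsq hg hp
  obtain ⟨k, hk, hkσ⟩ := exists_C_sub_mem hsq hN₁ σ
  obtain ⟨r, hr, hrp⟩ := exists_C_sub_mem hsq hN₁ (-p)
  have hkσ' : MvPolynomial.C (k + 1) - σ ∈ T := by
    rw [MvPolynomial.C_add, add_sub_right_comm]
    exact add_mem hkσ (C_mem_of_nonneg hsq zero_le_one)
  by_contra hpT
  have hneg : ∀ r : ℝ, MvPolynomial.C r + p ∈ T → 0 ≤ r := by
    intro r hr
    by_contra! hlt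
    refine hpT ?_
    have := add_mem hr (C_mem_of_nonneg hsq (neg_nonneg.2 hlt.le))
    rwa [MvPolynomial.C_neg, add_neg_cancel_comm] at this
  have hstep : ∀ r : ℝ, MvPolynomial.C r + p ∈ T → MvPolynomial.C (r - 1 / (k + 1)) + p ∈ T := by
    intro r hr
    have h1 := add_mem (add_mem (mul_mem hkσ' hr) hτ)
      (mul_mem (C_mem_of_nonneg hsq (hneg r hr)) hσ)
    have h2 := mul_mem (C_mem_of_nonneg (T := T) hsq (r := 1 / (k + 1)) (by positivity)) h1
    have h3 : (MvPolynomial.C (1 / (k + 1)) : MvPolynomial (Fin n) ℝ) * MvPolynomial.C (k + 1) = 1 := by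
      rw [← MvPolynomial.C_mul, one_div_mul_cancel (by positivity), MvPolynomial.C_1]
    convert h2 using 1
    rw [MvPolynomial.C_sub]
    linear_combination -(MvPolynomial.C r + p) * h3 + MvPolynomial.C (1 / (k + 1)) * h
  have hiter : ∀ i : ℕ, MvPolynomial.C (r - i * (1 / (k + 1))) + p ∈ T := by
    intro i
    induction i with
    | zero => simpa using hrp
    | succ i ih =>
      have := hstep _ ih
      rwa [sub_sub, ← add_one_mul, ← Nat.cast_succ] at this
  obtain ⟨i, hi⟩ := exists_nat_gt (r * (k + 1))
  have := hneg _ (hiter i)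
  rw [mul_one_div, sub_nonneg, div_le_iff₀ (by positivity)] at this
  linarith

end Schmudgen

theorem Polynomial.isSumSq_of_forall_eval_nonneg {p : ℝ[X]} (hp : ∀ t, 0 ≤ p.eval t) :
    IsSumSq p := by
  induction hd : p.natDegree using Nat.strong_induction_on generalizing p with
  | _ d ih =>
  have hC : ∀ c : ℝ, 0 ≤ c → IsSumSq (C c : ℝ[X]) := fun c hc => by
    rw [← Real.mul_self_sqrt hc, C_mul]
    exact IsSumSq.mul_self _
  by_cases h0 : p.natDegree = 0
  · rw [eq_C_of_natDegree_eq_zero h0] at hp ⊢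
    exact hC _ (by simpa using hp 0)
  have htend : Filter.Tendsto (fun t => p.eval t) (Filter.cocompact ℝ) Filter.atTop := by
    have := p.tendsto_norm_atTop (natDegree_pos_iff_degree_pos.mp (Nat.pos_of_ne_zero h0))
      (tendsto_norm_cocompact_atTop (E := ℝ))
    simpa only [Real.norm_of_nonneg (hp _)] using this
  obtain ⟨s, hs⟩ := p.continuous.exists_forall_le htend
  obtain ⟨r, hr⟩ : X - C s ∣ p - C (p.eval s) := by
    simp [dvd_iff_isRoot]
  obtain ⟨q, hq⟩ : X - C s ∣ r := by
    have hder : p.derivative.eval s = 0 := by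
      have : IsLocalMin (fun t => p.eval t) s := Filter.Eventually.of_forall hs
      simpa using this.deriv_eq_zero
    have h1 := congrArg (fun u : ℝ[X] => u.derivative.eval s) hr
    rw [dvd_iff_isRoot]
    simpa [hder, eq_comm] using h1
  have hpq : p = C (p.eval s) + (X - C s) * (X - C s) * q := by
    linear_combination hr + (X - C s) * hq
  have hpe : ∀ t, p.eval t - p.eval s = (t - s) * (t - s) * q.eval t := fun t => by
    conv_lhs => rw [hpq]
    simp
  have hne : ∀ t, t ≠ s → 0 ≤ q.eval t := fun t ht => by
    refine (mul_nonneg_iff_of_pos_left (mul_self_pos.mpr (sub_ne_zero.mpr ht))).mp ?_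
    rw [← hpe]
    exact sub_nonneg.mpr (hs t)
  have hq0 : ∀ t, 0 ≤ q.eval t := fun t => by
    rcases eq_or_ne t s with rfl | ht
    · refine ge_of_tendsto ((q.continuous.tendsto t).mono_left
        (nhdsWithin_le_nhds (s := {t}ᶜ))) ?_
      filter_upwards [self_mem_nhdsWithin] with u hu using hne u hu
    · exact hne t ht
  have hdeg : q.natDegree < d := by
    by_cases hq' : q = 0
    · rw [hq', natDegree_zero]
      omega
    have h2 : (p - C (p.eval s)).natDegree = 2 + q.natDegree := by
      rw [hr, hq, ← mul_assoc, natDegree_mul (mul_ne_zero (X_sub_C_ne_zero s) (X_sub_C_ne_zero s))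
        hq', natDegree_mul (X_sub_C_ne_zero s) (X_sub_C_ne_zero s), natDegree_X_sub_C]
    rw [natDegree_sub_C] at h2
    omega
  rw [hpq]
  exact (hC _ (hp s)).add ((IsSumSq.mul_self _).mul (ih _ hdeg hq0 rfl))

theorem MvPolynomial.exists_near_of_continuous {n : ℕ} {K : Set (Fin n → ℝ)} (hK : IsCompact K)
    (f : K → ℝ) (hf : Continuous f) {ε : ℝ} (hε : 0 < ε) :
    ∃ p : MvPolynomial (Fin n) ℝ, ∀ x : K, |eval (x : Fin n → ℝ) p - f x| < ε := by
  have := isCompact_iff_compactSpace.mp hK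
  let Φ : MvPolynomial (Fin n) ℝ →ₐ[ℝ] C(K, ℝ) :=
    aeval fun i => ⟨fun x => (x : Fin n → ℝ) i, (continuous_apply i).comp continuous_subtype_val⟩
  have hΦ : ∀ p (x : K), Φ p x = eval (x : Fin n → ℝ) p := fun p x => by
    induction p using MvPolynomial.induction_on with
    | C a => simp [Φ]
    | add p q hp hq => simp [hp, hq]
    | mul_X p i hp => rw [map_mul, ContinuousMap.mul_apply, hp]; simp [Φ]
  have hsep : Φ.range.SeparatesPoints := fun x y hxy => by
    obtain ⟨i, hi⟩ := Function.ne_iff.mp (Subtype.coe_ne_coe.mpr hxy)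
    exact ⟨_, ⟨_, ⟨X i, rfl⟩, rfl⟩, by simpa [hΦ] using hi⟩
  obtain ⟨⟨_, p, rfl⟩, hp⟩ :=
    ContinuousMap.exists_mem_subalgebra_near_continuous_of_separatesPoints _ hsep f hf ε hε
  refine ⟨p, fun x => ?_⟩
  have := hp x
  rw [Real.norm_eq_abs] at this
  rw [← hΦ]
  exact this

/-- Finitely many polynomials can be interpolated simultaneously on a compact set, up to `ε`,
with positive polynomial weights. -/
theorem MvPolynomial.exists_pos_weights {n : ℕ} {K : Set (Fin n → ℝ)} (hK : IsCompact K)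
    (N : ℕ) (a : ℕ → MvPolynomial (Fin n) ℝ) {ε : ℝ} (hε : 0 < ε) :
    ∃ (s : Finset K) (φ : K → MvPolynomial (Fin n) ℝ),
      (∀ y ∈ s, ∀ x ∈ K, 0 < eval x (φ y)) ∧ ∀ k < N, ∀ x ∈ K,
        |eval x (a k) - ∑ y ∈ s, eval x (φ y) * eval (y : Fin n → ℝ) (a k)| < ε := by
  have := isCompact_iff_compactSpace.mp hK
  let v : K → Fin N → ℝ := fun x k => eval (x : Fin n → ℝ) (a k)
  have hv : Continuous v := continuous_pi fun k =>
    (MvPolynomial.continuous_eval (a k)).comp continuous_subtype_val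
  obtain ⟨s, hs⟩ := isCompact_univ.elim_finite_subcover (fun y : K => {x : K | dist (v x) (v y) < ε / 2})
    (fun y => isOpen_lt (by fun_prop) continuous_const)
    (fun x _ => Set.mem_iUnion.mpr ⟨x, by simpa using hε⟩)
  let ψ : K → K → ℝ := fun y x => max 0 (ε / 2 - dist (v x) (v y))
  have hψ : ∀ y, Continuous (ψ y) := fun y => by fun_prop
  have hψ0 : ∀ y x, 0 ≤ ψ y x := fun y x => le_max_left _ _
  let S : K → ℝ := fun x => ∑ y ∈ s, ψ y x
  have hS : ∀ x, 0 < S x := fun x => by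
    obtain ⟨y, hy, hxy⟩ : ∃ y ∈ s, dist (v x) (v y) < ε / 2 := by
      simpa using hs (Set.mem_univ x)
    exact Finset.sum_pos' (fun y _ => hψ0 y x) ⟨y, hy, lt_max_of_lt_right (by linarith)⟩
  have hSc : Continuous S := continuous_finsetSum _ fun y _ => hψ y
  obtain ⟨M, hM⟩ : ∃ M : ℝ, 0 ≤ M ∧ ∀ k < N, ∑ y ∈ s, |eval (y : Fin n → ℝ) (a k)| ≤ M := by
    refine ⟨∑ k ∈ Finset.range N, ∑ y ∈ s, |eval (y : Fin n → ℝ) (a k)|, by positivity,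
      fun k hk => ?_⟩
    exact Finset.single_le_sum (f := fun k => ∑ y ∈ s, |eval (y : Fin n → ℝ) (a k)|)
      (fun _ _ => by positivity) (Finset.mem_range.mpr hk)
  let η : ℝ := ε / (4 * (M + 1))
  have hη : 0 < η := by have := hM.1; positivity
  have hηM : 2 * η * M < ε / 2 := by
    have := hM.1
    simp only [η]
    rw [mul_div_assoc', div_mul_eq_mul_div, div_lt_iff₀ (by positivity)]
    nlinarith
  choose φ hφ using fun y => exists_near_of_continuous hK (fun x => ψ y x / S x + η)
    (((hψ y).div hSc fun x => (hS x).ne').add continuous_const) hη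
  refine ⟨s, φ, fun y _ x hx => ?_, fun k hk x hx => ?_⟩
  · have h1 := (abs_lt.mp (hφ y ⟨x, hx⟩)).1
    have h2 : 0 ≤ ψ y ⟨x, hx⟩ / S ⟨x, hx⟩ := div_nonneg (hψ0 _ _) (hS _).le
    simp only at h1
    linarith
  · set x' : K := ⟨x, hx⟩
    have hsum : ∑ y ∈ s, ψ y x' / S x' = 1 := by
      rw [← Finset.sum_div]
      exact div_self (hS x').ne'
    have h1 : |∑ y ∈ s, ψ y x' / S x' * (eval x (a k) - eval (y : Fin n → ℝ) (a k))| ≤ ε / 2 := by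
      calc _ ≤ ∑ y ∈ s, ψ y x' / S x' * (ε / 2) := by
            refine (Finset.abs_sum_le_sum_abs _ _).trans (Finset.sum_le_sum fun y _ => ?_)
            have h0 : 0 ≤ ψ y x' / S x' := div_nonneg (hψ0 _ _) (hS _).le
            rw [abs_mul, abs_of_nonneg h0]
            rcases le_or_gt (ε / 2) (dist (v x') (v y)) with h | h
            · have : ψ y x' = 0 := max_eq_left (by linarith)
              simp [this]
            · refine mul_le_mul_of_nonneg_left (le_trans ?_ h.le) h0
              exact dist_le_pi_dist (v x') (v y) ⟨k, hk⟩
        _ = ε / 2 := by rw [← Finset.sum_mul, hsum, one_mul]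
    have h2 : |∑ y ∈ s, (ψ y x' / S x' - eval x (φ y)) * eval (y : Fin n → ℝ) (a k)|
        ≤ 2 * η * M := by
      calc _ ≤ ∑ y ∈ s, 2 * η * |eval (y : Fin n → ℝ) (a k)| := by
            refine (Finset.abs_sum_le_sum_abs _ _).trans (Finset.sum_le_sum fun y _ => ?_)
            rw [abs_mul]
            refine mul_le_mul_of_nonneg_right ?_ (abs_nonneg _)
            have h3 := abs_lt.mp (hφ y x')
            simp only [x'] at h3
            exact abs_le.mpr ⟨by linarith [h3.2], by linarith [h3.1]⟩
        _ ≤ 2 * η * M := by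
            rw [← Finset.mul_sum]
            exact mul_le_mul_of_nonneg_left (hM.2 k hk) (by positivity)
    have h3 : eval x (a k) - ∑ y ∈ s, eval x (φ y) * eval (y : Fin n → ℝ) (a k) =
        ∑ y ∈ s, ψ y x' / S x' * (eval x (a k) - eval (y : Fin n → ℝ) (a k)) +
        ∑ y ∈ s, (ψ y x' / S x' - eval x (φ y)) * eval (y : Fin n → ℝ) (a k) := by
      simp only [mul_sub, sub_mul, Finset.sum_sub_distrib, ← Finset.sum_mul, hsum]
      ring
    rw [h3]
    exact (abs_add_le _ _).trans_lt (by linarith)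

section Nonneg

variable {n m : ℕ} {g : Fin m → MvPolynomial (Fin n) ℝ}
  {L : (MvPolynomial (Fin n) ℝ)[X] →ₗ[ℝ] ℝ}

theorem nonneg_sq_mul_C_of_mem
    (hL : ∀ (β : Fin m → Bool) (h : (MvPolynomial (Fin n) ℝ)[X]),
      0 ≤ L (h ^ 2 * C (∏ j, if β j then g j else 1)))
    {p : MvPolynomial (Fin n) ℝ} (hp : p ∈ generatedPreordering g)
    (h : (MvPolynomial (Fin n) ℝ)[X]) : 0 ≤ L (h ^ 2 * C p) := by
  refine AddSubmonoid.closure_induction (fun s hs => ?_) (by simp) (fun x y _ _ hx hy => ?_) hp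
  · obtain ⟨β, a, rfl⟩ := hs
    rw [C_mul, C_pow, ← mul_assoc, ← mul_pow]
    exact hL β _
  · rw [C_add, mul_add, map_add]
    exact add_nonneg hx hy

theorem nonneg_C_mul_map_C
    (hL : ∀ p ∈ generatedPreordering g, ∀ h : (MvPolynomial (Fin n) ℝ)[X], 0 ≤ L (h ^ 2 * C p))
    {p : MvPolynomial (Fin n) ℝ} (hp : p ∈ generatedPreordering g) {q : ℝ[X]}
    (hq : ∀ t, 0 ≤ q.eval t) : 0 ≤ L (C p * q.map MvPolynomial.C) := by
  have hq' := isSumSq_of_forall_eval_nonneg hq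
  clear hq
  induction hq' with
  | zero => simp
  | sq_add a _ ih =>
    rw [Polynomial.map_add, mul_add, map_add, Polynomial.map_mul, mul_comm, ← sq]
    exact add_nonneg (hL p hp _) ih

theorem neg_half_mul_le_C_mul_X_pow
    (hL : ∀ p ∈ generatedPreordering g, ∀ h : (MvPolynomial (Fin n) ℝ)[X], 0 ≤ L (h ^ 2 * C p))
    {e : MvPolynomial (Fin n) ℝ} {ε : ℝ} (h₁ : MvPolynomial.C ε + e ∈ generatedPreordering g)
    (h₂ : MvPolynomial.C ε - e ∈ generatedPreordering g) (k : ℕ) :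
    -(ε / 2 * L (1 + X ^ (2 * k))) ≤ L (C e * X ^ k) := by
  have h := add_nonneg (hL _ h₁ (1 + X ^ k)) (hL _ h₂ (1 - X ^ k))
  have h' : (1 + X ^ k) ^ 2 * C (MvPolynomial.C ε + e) + (1 - X ^ k) ^ 2 * C (MvPolynomial.C ε - e)
      = (2 * ε) • (1 + X ^ (2 * k)) + (4 : ℝ) • (C e * X ^ k) := by
    have hsmul : ∀ (c : ℝ) (q : (MvPolynomial (Fin n) ℝ)[X]), c • q = C (MvPolynomial.C c) * q :=
      fun c q => by rw [Algebra.smul_def]; rfl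
    simp only [hsmul, C_add, C_sub, map_mul, map_ofNat]
    ring
  rw [← map_add, h', map_add, map_smul, map_smul, smul_eq_mul, smul_eq_mul] at h
  linarith

theorem nonneg_of_forall_eval_nonneg
    (hK : IsCompact {x : Fin n → ℝ | ∀ j, 0 ≤ MvPolynomial.eval x (g j)})
    (hL : ∀ (β : Fin m → Bool) (h : (MvPolynomial (Fin n) ℝ)[X]),
      0 ≤ L (h ^ 2 * C (∏ j, if β j then g j else 1)))
    {f : (MvPolynomial (Fin n) ℝ)[X]}
    (hf : ∀ x, (∀ j, 0 ≤ MvPolynomial.eval x (g j)) →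
      ∀ t, 0 ≤ (f.map (MvPolynomial.eval x)).eval t) : 0 ≤ L f := by
  have hL' : ∀ p ∈ generatedPreordering g, ∀ h : (MvPolynomial (Fin n) ℝ)[X],
    0 ≤ L (h ^ 2 * C p) := fun p hp h => nonneg_sq_mul_C_of_mem hL hp h
  let N := f.natDegree + 1
  let B : ℝ := ∑ k ∈ Finset.range N, L (1 + X ^ (2 * k))
  suffices H : ∀ ε : ℝ, 0 < ε → -(ε / 2 * B) ≤ L f by
    have hlim : Filter.Tendsto (fun ε : ℝ => -(ε / 2 * B)) (nhdsWithin 0 (Set.Ioi 0)) (nhds 0) := by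
      have : Continuous fun ε : ℝ => -(ε / 2 * B) := by fun_prop
      simpa using (this.tendsto 0).mono_left nhdsWithin_le_nhds
    refine le_of_tendsto hlim ?_
    filter_upwards [self_mem_nhdsWithin] with ε hε using H ε hε
  intro ε hε
  obtain ⟨s, φ, hφ, hs⟩ := MvPolynomial.exists_pos_weights hK N f.coeff hε
  let e : ℕ → MvPolynomial (Fin n) ℝ := fun k =>
    f.coeff k - ∑ y ∈ s, φ y * MvPolynomial.C (MvPolynomial.eval (y : Fin n → ℝ) (f.coeff k))
  have hdecomp : f = (∑ y ∈ s, C (φ y) *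
      ((f.map (MvPolynomial.eval (y : Fin n → ℝ))).map MvPolynomial.C)) +
      ∑ k ∈ Finset.range N, C (e k) * X ^ k := by
    ext1 k
    simp only [coeff_add, finsetSum_coeff, coeff_C_mul, coeff_map, coeff_X_pow, mul_ite,
      mul_one, mul_zero, Finset.sum_ite_eq, Finset.mem_range]
    split_ifs with hk
    · simp [e]
    · have : f.coeff k = 0 := coeff_eq_zero_of_natDegree_lt (by omega)
      simp [this]
  have he : ∀ k < N, ∀ x : Fin n → ℝ, (∀ j, 0 ≤ MvPolynomial.eval x (g j)) →
      |MvPolynomial.eval x (e k)| < ε := fun k hk x hx => by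
    simpa [e] using hs k hk x hx
  rw [hdecomp, map_add, map_sum, map_sum]
  have h1 : 0 ≤ ∑ y ∈ s, L (C (φ y) *
      ((f.map (MvPolynomial.eval (y : Fin n → ℝ))).map MvPolynomial.C)) :=
    Finset.sum_nonneg fun y hy => nonneg_C_mul_map_C hL'
      (mem_generatedPreordering_of_pos hK (hφ y hy)) (hf y y.2)
  have h2 : ∑ k ∈ Finset.range N, -(ε / 2 * L (1 + X ^ (2 * k))) ≤
      ∑ k ∈ Finset.range N, L (C (e k) * X ^ k) := by
    refine Finset.sum_le_sum fun k hk => ?_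
    have hk' := he k (Finset.mem_range.mp hk)
    refine neg_half_mul_le_C_mul_X_pow hL' (mem_generatedPreordering_of_pos hK fun x hx => ?_)
      (mem_generatedPreordering_of_pos hK fun x hx => ?_) k
    · have := (abs_lt.mp (hk' x hx)).1
      simp only [map_add, MvPolynomial.eval_C]
      linarith
    · have := (abs_lt.mp (hk' x hx)).2
      simp only [map_sub, MvPolynomial.eval_C]
      linarith
  rw [Finset.sum_neg_distrib, ← Finset.mul_sum] at h2
  linarith

end Nonneg

section Haviland

open scoped CompactlySupported

variable {Y A : Type*} [TopologicalSpace Y] [CommRing A] [Algebra ℝ A]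

theorem exists_positive_extension (ev : A →ₐ[ℝ] C(Y, ℝ)) (L : A →ₗ[ℝ] ℝ)
    (hL : ∀ a, (∀ y, 0 ≤ ev a y) → 0 ≤ L a) :
    ∃ Λ : C_c(Y, ℝ) →ₗ[ℝ] ℝ,
      ∀ (a : A) (F : C_c(Y, ℝ)), (∀ y, 0 ≤ ev a y + F y) → 0 ≤ L a + Λ F := by
  let s : PointedCone ℝ (A × C_c(Y, ℝ)) :=
    { carrier := {q | ∀ y, 0 ≤ ev q.1 y + q.2 y}
      zero_mem' := by simp
      smul_mem' := fun c q hq y => by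
        have h : ev ((c : ℝ) • q.1) y + (c : ℝ) * q.2 y = c * (ev q.1 y + q.2 y) := by
          rw [map_smul, ContinuousMap.smul_apply, smul_eq_mul, mul_add]
        exact (mul_nonneg c.2 (hq y)).trans_eq h.symm
      add_mem' := fun {p q} hp hq y => by
        have := add_nonneg (hp y) (hq y)
        simp only [Prod.fst_add, Prod.snd_add, map_add, ContinuousMap.add_apply,
          CompactlySupportedContinuousMap.add_apply]
        linarith }
  let f : (A × C_c(Y, ℝ)) →ₗ.[ℝ] ℝ :=
    { domain := Submodule.prod ⊤ ⊥
      toFun := (L ∘ₗ LinearMap.fst ℝ A C_c(Y, ℝ)) ∘ₗ Submodule.subtype _ }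
  obtain ⟨G, hGf, hGs⟩ := riesz_extension s f
    (fun x hx => hL _ fun y => by
      have h := hx y
      have h0 : x.1.2 = 0 := (Submodule.mem_bot ℝ).mp x.2.2
      rw [h0] at h
      simpa using h)
    (fun q => by
      obtain ⟨c, hc⟩ := q.2.hasCompactSupport.exists_bound_of_continuous q.2.continuous
      refine ⟨⟨(algebraMap ℝ A c - q.1, 0), ⟨trivial, Submodule.zero_mem _⟩⟩, fun y => ?_⟩
      have := (abs_le.mp (hc y)).1
      have h1 : ev (algebraMap ℝ A c - q.1 + q.1) y = c := by simp
      change 0 ≤ ev (algebraMap ℝ A c - q.1 + q.1) y + (0 + q.2) y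
      rw [h1, zero_add]
      linarith)
  refine ⟨G ∘ₗ LinearMap.inr ℝ A C_c(Y, ℝ), fun a F h => ?_⟩
  have h1 : G (a, 0) = L a := hGf ⟨(a, 0), ⟨trivial, Submodule.zero_mem _⟩⟩
  have h2 := hGs (a, F) h
  have h3 : (a, F) = (a, (0 : C_c(Y, ℝ))) + (0, F) := by simp
  rw [h3, map_add, h1] at h2
  exact h2

/-- **Haviland's theorem** for an algebra of continuous functions containing a proper one. -/
theorem exists_measure_integral_eq [T2Space Y] [LocallyCompactSpace Y] [MeasurableSpace Y]
    [BorelSpace Y] (ev : A →ₐ[ℝ] C(Y, ℝ)) (L : A →ₗ[ℝ] ℝ)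
    (hL : ∀ a, (∀ y, 0 ≤ ev a y) → 0 ≤ L a) (τ : A)
    (hτ : ∀ r : ℝ, IsCompact {y | ev τ y ^ 2 ≤ r}) :
    ∃ μ : Measure Y, ∀ a, Integrable (ev a) μ ∧ ∫ y, ev a y ∂μ = L a := by
  obtain ⟨Λ, hΛ⟩ := exists_positive_extension ev L hL
  let Λ' : C_c(Y, ℝ) →ₚ[ℝ] ℝ := PositiveLinearMap.mk₀ Λ fun F hF => by
    simpa using hΛ 0 F fun y => by simpa using hF y
  let μ := RealRMK.rieszMeasure Λ'
  have hμ : ∀ F : C_c(Y, ℝ), ∫ y, F y ∂μ = Λ F := fun F => RealRMK.integral_rieszMeasure Λ' F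
  let χ : ℕ → Y → ℝ := fun r y => max 0 (1 - ev τ y ^ 2 / (r + 1))
  have hχ0 : ∀ r y, 0 ≤ χ r y := fun r y => le_max_left _ _
  have hχ1 : ∀ r y, χ r y ≤ 1 := fun r y => max_le zero_le_one (by
    have : 0 ≤ ev τ y ^ 2 / (r + 1) := by positivity
    linarith)
  have hχτ : ∀ r y, 1 - χ r y ≤ ev τ y ^ 2 / (r + 1) := fun r y => by
    have : 1 - ev τ y ^ 2 / (r + 1) ≤ χ r y := le_max_right _ _
    linarith
  have hχlim : ∀ y, Filter.Tendsto (fun r => χ r y) Filter.atTop (nhds 1) := fun y => by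
    have h : Filter.Tendsto (fun r : ℕ => 1 - ev τ y ^ 2 / ((r : ℝ) + 1)) Filter.atTop
        (nhds 1) := by
      simpa [div_eq_mul_inv] using
        ((tendsto_one_div_add_atTop_nhds_zero_nat (𝕜 := ℝ)).const_mul (ev τ y ^ 2)).const_sub 1
    exact tendsto_of_tendsto_of_tendsto_of_le_of_le h tendsto_const_nhds
      (fun r => le_max_right _ _) (fun r => hχ1 r y)
  let Φ : A → ℕ → C_c(Y, ℝ) := fun a r =>
    { toFun := fun y => ev a y * χ r y
      continuous_toFun := by fun_prop
      hasCompactSupport' := HasCompactSupport.intro (hτ (r + 1)) fun y hy => by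
        have : χ r y = 0 := max_eq_left (by
          rw [sub_nonpos, le_div_iff₀ (by positivity), one_mul]
          exact (not_le.mp hy).le)
        rw [this, mul_zero] }
  have hΦ : ∀ a r y, Φ a r y = ev a y * χ r y := fun _ _ _ => rfl
  have hΦint : ∀ a r, Integrable (Φ a r) μ := fun a r =>
    (Φ a r).continuous.integrable_of_hasCompactSupport (Φ a r).hasCompactSupport
  have hint_nonneg : ∀ a, (∀ y, 0 ≤ ev a y) → Integrable (ev a) μ := fun a ha => by
    refine ⟨(ev a).continuous.aestronglyMeasurable, ?_⟩
    rw [hasFiniteIntegral_iff_ofReal (Filter.Eventually.of_forall ha)]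
    refine lt_of_le_of_lt ?_ (ENNReal.ofReal_lt_top (r := L a))
    have hlim : ∀ y, Filter.liminf (fun r => ENNReal.ofReal (Φ a r y)) Filter.atTop =
        ENNReal.ofReal (ev a y) := fun y => by
      refine (ENNReal.tendsto_ofReal ?_).liminf_eq
      simpa [hΦ] using (hχlim y).const_mul (ev a y)
    simp_rw [← hlim]
    refine (lintegral_liminf_le fun r =>
      ENNReal.measurable_ofReal.comp (Φ a r).continuous.measurable).trans ?_
    refine Filter.liminf_le_of_le (by isBoundedDefault) fun b hb => ?_
    obtain ⟨r, hr⟩ := hb.exists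
    refine hr.trans ?_
    change ∫⁻ y, ENNReal.ofReal (Φ a r y) ∂μ ≤ _
    rw [← ofReal_integral_eq_lintegral_ofReal (hΦint a r)
      (Filter.Eventually.of_forall fun y => mul_nonneg (ha y) (hχ0 r y)), hμ]
    refine ENNReal.ofReal_le_ofReal ?_
    have := hΛ a (-Φ a r) fun y => by
      have := mul_le_mul_of_nonneg_left (hχ1 r y) (ha y)
      simp only [CompactlySupportedContinuousMap.neg_apply, hΦ]
      linarith
    rw [map_neg] at this
    linarith
  have hint : ∀ a, Integrable (ev a) μ := fun a => by
    refine (hint_nonneg (1 + a ^ 2) fun y => ?_).mono' (ev a).continuous.aestronglyMeasurable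
      (Filter.Eventually.of_forall fun y => ?_)
    · simp only [map_add, map_one, map_pow, ContinuousMap.add_apply, ContinuousMap.one_apply,
        ContinuousMap.pow_apply]
      positivity
    · simp only [map_add, map_one, map_pow, ContinuousMap.add_apply, ContinuousMap.one_apply,
        ContinuousMap.pow_apply, Real.norm_eq_abs]
      nlinarith [sq_abs (ev a y), sq_nonneg (|ev a y| - 1), sq_nonneg (ev a y)]
  refine ⟨μ, fun a => ⟨hint a, ?_⟩⟩
  have hlim₁ : Filter.Tendsto (fun r => Λ (Φ a r)) Filter.atTop (nhds (∫ y, ev a y ∂μ)) := by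
    simp_rw [← hμ]
    refine tendsto_integral_of_dominated_convergence (fun y => ‖ev a y‖)
      (fun r => (Φ a r).continuous.aestronglyMeasurable) (hint a).norm
      (fun r => Filter.Eventually.of_forall fun y => ?_)
      (Filter.Eventually.of_forall fun y => ?_)
    · rw [hΦ, norm_mul, Real.norm_of_nonneg (hχ0 r y)]
      exact mul_le_of_le_one_right (norm_nonneg _) (hχ1 r y)
    · simpa [hΦ] using (hχlim y).const_mul (ev a y)
  have hbound : ∀ r : ℕ, |Λ (Φ a r) - L a| ≤ L ((1 + a ^ 2) * τ ^ 2) * (1 / ((r : ℝ) + 1)) := by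
    intro r
    have key : ∀ y, |ev a y * (1 - χ r y)| ≤
        (1 / ((r : ℝ) + 1)) * ev ((1 + a ^ 2) * τ ^ 2) y := fun y => by
      rw [abs_mul, abs_of_nonneg (sub_nonneg.mpr (hχ1 r y))]
      have h1 : |ev a y| ≤ 1 + ev a y ^ 2 := by
        nlinarith [sq_abs (ev a y), sq_nonneg (|ev a y| - 1), sq_nonneg (ev a y)]
      refine (mul_le_mul h1 (hχτ r y) (sub_nonneg.mpr (hχ1 r y)) (by positivity)).trans_eq ?_
      simp only [map_mul, map_add, map_one, map_pow, ContinuousMap.mul_apply,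
        ContinuousMap.add_apply, ContinuousMap.one_apply, ContinuousMap.pow_apply]
      ring
    have h1 := hΛ ((1 / ((r : ℝ) + 1)) • ((1 + a ^ 2) * τ ^ 2) - a) (Φ a r) fun y => by
      have := (abs_le.mp (key y)).2
      rw [map_sub, map_smul, ContinuousMap.sub_apply, ContinuousMap.smul_apply, smul_eq_mul, hΦ]
      linarith
    have h2 := hΛ ((1 / ((r : ℝ) + 1)) • ((1 + a ^ 2) * τ ^ 2) + a) (-Φ a r) fun y => by
      have := (abs_le.mp (key y)).1
      rw [map_add, map_smul, ContinuousMap.add_apply, ContinuousMap.smul_apply, smul_eq_mul,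
        CompactlySupportedContinuousMap.neg_apply, hΦ]
      linarith
    rw [map_sub, map_smul, smul_eq_mul] at h1
    rw [map_add, map_smul, map_neg, smul_eq_mul] at h2
    exact abs_le.mpr ⟨by linarith, by linarith⟩
  have hlim₂ : Filter.Tendsto (fun r => Λ (Φ a r)) Filter.atTop (nhds (L a)) := by
    rw [tendsto_iff_norm_sub_tendsto_zero]
    refine squeeze_zero (fun _ => norm_nonneg _) hbound ?_
    simpa using (tendsto_one_div_add_atTop_nhds_zero_nat (𝕜 := ℝ)).const_mul
      (L ((1 + a ^ 2) * τ ^ 2))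
  exact tendsto_nhds_unique hlim₁ hlim₂

end Haviland

theorem riesz_eq_sum_constr {n : ℕ} (z : (Fin n →₀ ℕ) × ℕ → ℝ)
    (f : (MvPolynomial (Fin n) ℝ)[X]) :
    riesz z f =
      f.sum fun k c => (MvPolynomial.basisMonomials (Fin n) ℝ).constr ℝ (fun α => z (α, k)) c := by
  rw [riesz]
  congr 1
  ext k c
  rw [Module.Basis.constr_apply]
  rfl

/-- The functional `riesz z` as a linear map. -/
noncomputable def rieszLinearMap {n : ℕ} (z : (Fin n →₀ ℕ) × ℕ → ℝ) :
    (MvPolynomial (Fin n) ℝ)[X] →ₗ[ℝ] ℝ where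
  toFun := riesz z
  map_add' p q := by
    simp only [riesz_eq_sum_constr]
    exact sum_add_index p q _ (fun _ => map_zero _) fun _ _ _ => map_add _ _ _
  map_smul' c p := by
    simp only [riesz_eq_sum_constr, RingHom.id_apply]
    rw [sum_smul_index' p c _ fun _ => map_zero _, Polynomial.smul_sum]
    simp only [map_smul]

theorem riesz_C_monomial_mul_X_pow {n : ℕ} (z : (Fin n →₀ ℕ) × ℕ → ℝ) (α : Fin n →₀ ℕ) (k : ℕ) :
    riesz z (C (MvPolynomial.monomial α 1) * X ^ k) = z (α, k) := by
  rw [riesz, C_mul_X_pow_eq_monomial, sum_monomial_index _ _ (by simp)]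
  simp [MvPolynomial.support_monomial]

/-- Evaluation of polynomials in `ℝ[x₁,…,xₙ][t]` at the points of `K × ℝ`. -/
noncomputable def evalProd {n : ℕ} (K : Set (Fin n → ℝ)) :
    (MvPolynomial (Fin n) ℝ)[X] →ₐ[ℝ] C(K × ℝ, ℝ) :=
  let φ : MvPolynomial (Fin n) ℝ →ₐ[ℝ] C(K × ℝ, ℝ) := MvPolynomial.aeval fun i =>
    ⟨fun y => (y.1 : Fin n → ℝ) i,
      (continuous_apply i).comp (continuous_subtype_val.comp continuous_fst)⟩
  { eval₂RingHom φ.toRingHom ⟨Prod.snd, continuous_snd⟩ with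
    commutes' := fun r => (eval₂_C _ _).trans (φ.commutes r) }

theorem evalProd_apply {n : ℕ} {K : Set (Fin n → ℝ)} (f : (MvPolynomial (Fin n) ℝ)[X])
    (y : K × ℝ) :
    evalProd K f y = (f.map (MvPolynomial.eval (y.1 : Fin n → ℝ))).eval y.2 := by
  have hC : ∀ p : MvPolynomial (Fin n) ℝ,
      evalProd K (C p) y = MvPolynomial.eval (y.1 : Fin n → ℝ) p := fun p => by
    induction p using MvPolynomial.induction_on with
    | C a => simp [evalProd]
    | add p q hp hq => rw [C_add, map_add, ContinuousMap.add_apply, hp, hq, map_add]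
    | mul_X p i hp =>
      rw [C_mul, map_mul, ContinuousMap.mul_apply, hp, map_mul]
      simp [evalProd]
  have hX : evalProd K X y = y.2 := by simp [evalProd]
  induction f using Polynomial.induction_on' with
  | add p q hp hq => simp [hp, hq]
  | monomial k a =>
    rw [← C_mul_X_pow_eq_monomial, map_mul, map_pow, ContinuousMap.mul_apply,
      ContinuousMap.pow_apply, hC, hX]
    simp

/-- Corollary 2.4 of the paper, "if" part. Let `K = {x : gⱼ(x) ≥ 0}` be
compact. If a real sequence `z = (z_{αk})` satisfies `L_z(h² ⬝ g^β) ≥ 0` for all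
`β ∈ {0,1}^m` and all `h ∈ ℝ[x,t]`, then `z` has a representing finite Borel measure on
`K × ℝ`. -/
theorem exists_representing_measure_of_riesz_nonneg
    {n m : ℕ} (g : Fin m → MvPolynomial (Fin n) ℝ)
    (K : Set (Fin n → ℝ))
    (hKdef : K = {x : Fin n → ℝ | ∀ j, 0 ≤ MvPolynomial.eval x (g j)})
    (hK : IsCompact K)
    (z : (Fin n →₀ ℕ) × ℕ → ℝ)
    (hz : ∀ (β : Fin m → Bool) (h : Polynomial (MvPolynomial (Fin n) ℝ)),
      0 ≤ riesz z (h ^ 2 * Polynomial.C (∏ j, if β j then g j else 1))) :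
    ∃ ν : Measure ((Fin n → ℝ) × ℝ), IsFiniteMeasure ν ∧
      ν {p : (Fin n → ℝ) × ℝ | p.1 ∉ K} = 0 ∧
      (∀ (α : Fin n →₀ ℕ) (k : ℕ),
        Integrable (fun p : (Fin n → ℝ) × ℝ => (∏ i, p.1 i ^ α i) * p.2 ^ k) ν) ∧
      (∀ (α : Fin n →₀ ℕ) (k : ℕ),
        z (α, k) = ∫ p : (Fin n → ℝ) × ℝ, (∏ i, p.1 i ^ α i) * p.2 ^ k ∂ν) := by
  have := isCompact_iff_compactSpace.mp hK
  have hτ : ∀ r : ℝ, IsCompact {y : K × ℝ | evalProd K X y ^ 2 ≤ r} := fun r => by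
    refine (isCompact_univ.prod (isCompact_Icc (a := -√r) (b := √r))).of_isClosed_subset
      (isClosed_le (by fun_prop) continuous_const) fun y hy => ⟨trivial, ?_⟩
    have hy' : y.2 ^ 2 ≤ r := by simpa [evalProd_apply] using hy
    exact abs_le.mp (Real.abs_le_sqrt hy')
  have hL : ∀ f, (∀ y, 0 ≤ evalProd K f y) → 0 ≤ rieszLinearMap z f := fun f hf =>
    nonneg_of_forall_eval_nonneg (hKdef ▸ hK) hz fun x hx t => by
      simpa only [evalProd_apply] using hf (⟨x, hKdef ▸ hx⟩, t)
  obtain ⟨μ, hμ⟩ := exists_measure_integral_eq (evalProd K) (rieszLinearMap z) hL X hτ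
  let ι : K × ℝ → (Fin n → ℝ) × ℝ := Prod.map Subtype.val id
  have hι : MeasurableEmbedding ι :=
    (MeasurableEmbedding.subtype_coe hK.measurableSet).prodMap MeasurableEmbedding.id
  have hmono : ∀ (α : Fin n →₀ ℕ) (k : ℕ),
      (fun p : (Fin n → ℝ) × ℝ => (∏ i, p.1 i ^ α i) * p.2 ^ k) ∘ ι =
        evalProd K (C (MvPolynomial.monomial α 1) * X ^ k) := fun α k => by
    ext y
    rw [evalProd_apply, Polynomial.map_mul, map_C, MvPolynomial.eval_monomial,
      Finsupp.prod_fintype _ _ fun _ => pow_zero _]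
    simp only [one_mul, Polynomial.map_pow, map_X, eval_mul, eval_C, eval_pow, eval_X]
    rfl
  refine ⟨μ.map ι, ⟨?_⟩, ?_, fun α k => ?_, fun α k => ?_⟩
  · have h1 : Integrable (fun _ : K × ℝ => (1 : ℝ)) μ := by
      have h := (hμ 1).1
      rw [map_one] at h
      exact h
    rw [hι.map_apply, Set.preimage_univ]
    simpa [integrable_const_iff, isFiniteMeasure_iff] using h1
  · rw [hι.map_apply]
    convert measure_empty (μ := μ)
    ext y
    simp [ι]
  · rw [hι.integrable_map_iff, hmono]
    exact (hμ _).1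
  · rw [hι.integral_map]
    change _ = ∫ y, ((fun p : (Fin n → ℝ) × ℝ => (∏ i, p.1 i ^ α i) * p.2 ^ k) ∘ ι) y ∂μ
    rw [hmono, (hμ _).2]
    exact (riesz_C_monomial_mul_X_pow z α k).symm
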